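/- Let n ≥ 4 and R ≥ 1, and let u be a smooth function on {x ∈ ℝⁿ : |x| ≥ R} with u = O(−(n−1)) and Δu = O(−2n). Then there exist harmonic homogeneous polynomials p_k of degree k on ℝⁿ, for k = 1, …, n−1, and ε ∈ (0,1), such that u(x) − Σ_{k=1}^{n−1} |x|^{2−n−2k} p_k(x) is O(−(2n−3)−ε) on {|x| ≥ R}. (In spherical-harmonic notation: u = Σ_{k=1}^{n−1} r^{−k−(n−2)} G_k + O(3−2n−ε), i.e. the terms of order r^{1−n} through r^{3−2n} in the expansion of u are harmonic functions on ℝⁿ∖{0}.) -/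

import Mathlib

open Real
open scoped BigOperators

noncomputable section

abbrev E (n : ℕ) := EuclideanSpace ℝ (Fin n)

/-- The Euclidean Laplacian of `f` at `x` (sum of second partial derivatives). -/
def lap (n : ℕ) (f : E n → ℝ) (x : E n) : ℝ :=
  ∑ i : Fin n, fderiv ℝ (fun y => fderiv ℝ f y (EuclideanSpace.single i 1)) x
    (EuclideanSpace.single i 1)

/-- `f` is a (real) polynomial function on `ℝⁿ`. -/
def IsPolyFun (n : ℕ) (f : E n → ℝ) : Prop :=
  ∃ P : MvPolynomial (Fin n) ℝ, ∀ x : E n, f x = MvPolynomial.eval (fun i => x i) P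

/-- `p` is a harmonic homogeneous polynomial of degree `m` on `ℝⁿ`. -/
def IsHHP (n m : ℕ) (p : E n → ℝ) : Prop :=
  IsPolyFun n p ∧ (∀ (c : ℝ) (x : E n), p (c • x) = c ^ m * p x) ∧ ∀ x : E n, lap n p x = 0

/-- The exterior region `{x : ℝⁿ | R ≤ |x|}`. -/
def Sset (n : ℕ) (R : ℝ) : Set (E n) := {x : E n | R ≤ ‖x‖}

/-- `u = O(-q)` on `{|x| ≥ R}`: all rescaled iterated derivatives decay like `|x|^{-q}`. -/
def BigOh (n : ℕ) (R q : ℝ) (u : E n → ℝ) : Prop :=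
  ∀ j : ℕ, ∃ C : ℝ, ∀ x ∈ Sset n R,
    ‖x‖ ^ j * ‖iteratedFDerivWithin ℝ j u (Sset n R) x‖ ≤ C * ‖x‖ ^ (-q)

/-- `u` has an expansion with terms in `A` up to order `-q` on `{|x| ≥ R}`. -/
def HasExpansion (n : ℕ) (R : ℝ) (A : Set (E n → ℝ)) (q : ℝ) (u : E n → ℝ) : Prop :=
  ∃ ε : ℝ, ε ∈ Set.Ioo (0:ℝ) 1 ∧ ∃ v ∈ Submodule.span ℝ A,
    BigOh n R (q + ε) (fun x => u x - v x)

/-- The Laplacian computed with derivatives within `{|x| ≥ R}`. -/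
def lapW (n : ℕ) (R : ℝ) (f : E n → ℝ) (x : E n) : ℝ :=
  ∑ i : Fin n, fderivWithin ℝ
    (fun y => fderivWithin ℝ f (Sset n R) y (EuclideanSpace.single i 1)) (Sset n R) x
    (EuclideanSpace.single i 1)

section Gegenbauer

/-- Homogenized Gegenbauer polynomials in a real algebra: the coefficients of `τ ^ k` in
`(1 - 2 s τ + q τ²) ^ (-l)`. -/
def gegenbauer {A : Type*} [CommRing A] [Algebra ℝ A] (l : ℝ) (s q : A) : ℕ → A
  | 0 => 1
  | 1 => (2 * l) • s
  | (k + 2) => ((k : ℝ) + 2)⁻¹ • ((2 * (k + 1) + 2 * l) • (s * gegenbauer l s q (k + 1))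
      - ((k : ℝ) + 2 * l) • (q * gegenbauer l s q k))

theorem map_gegenbauer {A B : Type*} [CommRing A] [Algebra ℝ A] [CommRing B] [Algebra ℝ B]
    (φ : A →ₐ[ℝ] B) (l : ℝ) (s q : A) (k : ℕ) :
    φ (gegenbauer l s q k) = gegenbauer l (φ s) (φ q) k := by
  induction k using Nat.twoStepInduction with
  | zero => simp [gegenbauer]
  | one => simp [gegenbauer]
  | more k h0 h1 => simp [gegenbauer, h0, h1]

theorem gegenbauer_scale (l ρ s q : ℝ) (k : ℕ) :
    gegenbauer l (ρ * s) (ρ ^ 2 * q) k = ρ ^ k * gegenbauer l s q k := by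
  induction k using Nat.twoStepInduction with
  | zero => simp [gegenbauer]
  | one => simp [gegenbauer]; ring
  | more k h0 h1 => simp only [gegenbauer, h0, h1, smul_eq_mul]; ring

theorem gegenbauer_bound (l : ℝ) (k : ℕ) :
    ∃ C, 0 ≤ C ∧ ∀ c q : ℝ, |c| ≤ 1 → |q| ≤ 1 → |gegenbauer l c q k| ≤ C := by
  induction k using Nat.twoStepInduction with
  | zero => exact ⟨1, by simp, by simp [gegenbauer]⟩
  | one =>
    refine ⟨|2 * l|, abs_nonneg _, fun c q hc _ => ?_⟩
    simp only [gegenbauer, smul_eq_mul]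
    rw [abs_mul]
    exact mul_le_of_le_one_right (abs_nonneg _) hc
  | more k h0 h1 =>
    obtain ⟨C0, hC0, h0⟩ := h0
    obtain ⟨C1, hC1, h1⟩ := h1
    refine ⟨|((k : ℝ) + 2)⁻¹| * (|2 * ((k : ℝ) + 1) + 2 * l| * (1 * C1)
        + |(k : ℝ) + 2 * l| * (1 * C0)),
      by positivity, fun c q hc hq => ?_⟩
    simp only [gegenbauer, smul_eq_mul]
    rw [abs_mul]
    gcongr
    refine (abs_sub _ _).trans ?_
    rw [abs_mul, abs_mul, abs_mul, abs_mul]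
    gcongr
    · exact h1 c q hc hq
    · exact h0 c q hc hq

/-- The truncated generating function solves the differential equation of
`(1 - 2 c t + t²) ^ (-l)` up to an error of order `t ^ N`. -/
theorem gegenbauer_ode (l c t : ℝ) (N : ℕ) :
    (∑ k ∈ Finset.range (N + 1), gegenbauer l c 1 k * (k * t ^ (k - 1))) * (1 - 2 * c * t + t ^ 2)
      - 2 * l * (c - t) * ∑ k ∈ Finset.range (N + 1), gegenbauer l c 1 k * t ^ k
    = t ^ N * (-(N + 1) * gegenbauer l c 1 (N + 1) + (N + 2 * l) * t * gegenbauer l c 1 N) := by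
  induction N with
  | zero => simp [gegenbauer]; ring
  | succ N ih =>
    rw [Finset.sum_range_succ, Finset.sum_range_succ (fun k => gegenbauer l c 1 k * t ^ k)]
    have hrec : ((N : ℝ) + 2) * gegenbauer l c 1 (N + 2) =
        (2 * (N + 1) + 2 * l) * (c * gegenbauer l c 1 (N + 1))
          - ((N : ℝ) + 2 * l) * gegenbauer l c 1 N := by
      simp only [gegenbauer, smul_eq_mul]
      have : (N : ℝ) + 2 ≠ 0 := by positivity
      field_simp
    simp only [Nat.add_sub_cancel]
    push_cast
    linear_combination ih + t ^ (N + 1) * hrec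

theorem gegenbauer_remainder (l : ℝ) (hl : 1 ≤ l) (N : ℕ) :
    ∃ M, 0 ≤ M ∧ ∀ c t : ℝ, |c| ≤ 1 → 0 ≤ t → t ≤ 1 / 2 →
      |(1 - 2 * c * t + t ^ 2) ^ (-l) - ∑ k ∈ Finset.range (N + 1), gegenbauer l c 1 k * t ^ k|
        ≤ M * t ^ (N + 1) := by
  obtain ⟨C0, hC0, h0⟩ := gegenbauer_bound l N
  obtain ⟨C1, hC1, h1⟩ := gegenbauer_bound l (N + 1)
  set B : ℝ := (N + 1) * C1 + (N + 2 * l) * C0 with hB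
  refine ⟨(1 / 4 : ℝ) ^ (-l) * (4 ^ (l - 1) * B), by positivity, fun c t hc ht0 ht => ?_⟩
  set w : ℝ → ℝ := fun t => 1 - 2 * c * t + t ^ 2 with hw
  set G : ℝ → ℝ := fun t => ∑ k ∈ Finset.range (N + 1), gegenbauer l c 1 k * t ^ k with hG
  have hc' := abs_le.1 hc
  have hwlo : ∀ s, 0 ≤ s → s ≤ 1 / 2 → 1 / 4 ≤ w s := fun s hs hs' => by
    simp only [hw]; nlinarith
  have hwhi : ∀ s, 0 ≤ s → s ≤ 1 / 2 → w s ≤ 4 := fun s hs hs' => by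
    simp only [hw]; nlinarith
  have hw' : ∀ s, HasDerivAt w (2 * s - 2 * c) s := fun s => by
    have := (((hasDerivAt_id s).const_mul (2 * c)).const_sub 1).add ((hasDerivAt_id s).pow 2)
    exact this.congr_deriv (by simp; ring)
  have hG' : ∀ s, HasDerivAt G (∑ k ∈ Finset.range (N + 1),
      gegenbauer l c 1 k * (k * s ^ (k - 1))) s := fun s => by
    simp only [hG]
    exact HasDerivAt.fun_sum fun k _ => (hasDerivAt_pow k s).const_mul _
  have hH' : ∀ s, 0 ≤ s → s ≤ 1 / 2 → HasDerivAt (fun s => G s * w s ^ l)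
      (w s ^ (l - 1) * (s ^ N * (-(N + 1) * gegenbauer l c 1 (N + 1)
        + (N + 2 * l) * s * gegenbauer l c 1 N))) s := fun s hs hs' => by
    have hpos : 0 < w s := by linarith [hwlo s hs hs']
    refine ((hG' s).mul ((hw' s).rpow_const (p := l) (Or.inl hpos.ne'))).congr_deriv ?_
    have hpow : w s ^ l = w s ^ (l - 1) * w s := by
      rw [← Real.rpow_add_one hpos.ne']; ring_nf
    rw [hpow, ← gegenbauer_ode l c s N]
    simp only [hw, hG]
    ring
  have hmv : ‖G t * w t ^ l - G 0 * w 0 ^ l‖ ≤ 4 ^ (l - 1) * B * t ^ N * ‖t - 0‖ := by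
    refine (convex_Icc (0 : ℝ) t).norm_image_sub_le_of_norm_hasDerivWithin_le
      (f := fun s => G s * w s ^ l)
      (fun s hs => (hH' s hs.1 (hs.2.trans ht)).hasDerivWithinAt) (fun s hs => ?_)
      (Set.left_mem_Icc.2 ht0) (Set.right_mem_Icc.2 ht0)
    have hs2 := hs.2.trans ht
    have hpos : 0 < w s := by linarith [hwlo s hs.1 hs2]
    rw [norm_mul, norm_mul, Real.norm_of_nonneg (by positivity : 0 ≤ w s ^ (l - 1)),
      Real.norm_of_nonneg (pow_nonneg hs.1 N), mul_assoc (4 ^ (l - 1)), mul_comm B]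
    gcongr
    · exact mul_nonneg (pow_nonneg hs.1 N) (norm_nonneg _)
    · exact hwhi s hs.1 hs2
    · exact hs.1
    · exact hs.2
    · refine (norm_add_le _ _).trans ?_
      rw [norm_mul, norm_mul, norm_mul, norm_neg]
      rw [Real.norm_of_nonneg (by positivity : (0:ℝ) ≤ N + 1),
        Real.norm_of_nonneg (by positivity : (0:ℝ) ≤ N + 2 * l), Real.norm_of_nonneg hs.1]
      have e1 := h1 c 1 hc (by simp)
      have e0 := h0 c 1 hc (by simp)
      simp only [Real.norm_eq_abs]
      have : (N + 2 * l) * s * |gegenbauer l c 1 N| ≤ (N + 2 * l) * C0 := by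
        calc _ ≤ (N + 2 * l) * 1 * C0 := by gcongr; linarith
          _ = _ := by ring
      have : ((N:ℝ) + 1) * |gegenbauer l c 1 (N + 1)| ≤ (N + 1) * C1 := by gcongr
      rw [hB]; linarith
  have hH0 : G 0 * w 0 ^ l = 1 := by
    simp [hG, hw, Finset.sum_range_succ', gegenbauer]
  rw [hH0, sub_zero, Real.norm_eq_abs, Real.norm_of_nonneg ht0] at hmv
  have hpos : 0 < w t := by linarith [hwlo t ht0 ht]
  have hmul : w t ^ (-l) * w t ^ l = 1 := by
    rw [← Real.rpow_add hpos]; simp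
  have : w t ^ (-l) - G t = - (w t ^ (-l) * (G t * w t ^ l - 1)) := by
    linear_combination (G t) * hmul
  change |w t ^ (-l) - G t| ≤ _
  rw [this, abs_neg, abs_mul, abs_of_nonneg (by positivity : 0 ≤ w t ^ (-l)), mul_assoc]
  refine mul_le_mul (Real.rpow_le_rpow_of_nonpos (by norm_num) (hwlo t ht0 ht) (by linarith))
    (hmv.trans_eq (by ring)) (abs_nonneg _) (by positivity)

end Gegenbauer

section GegenbauerPolynomial

open MvPolynomial

/-- The Laplacian on polynomials. -/
def polyLap (n : ℕ) (p : MvPolynomial (Fin n) ℝ) : MvPolynomial (Fin n) ℝ :=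
  ∑ i, pderiv i (pderiv i p)

/-- The linear form `X · y`. -/
def linForm {n : ℕ} (y : E n) : MvPolynomial (Fin n) ℝ := ∑ i, C (y i) * X i

/-- The quadratic form `|X|² |y|²`. -/
def quadForm {n : ℕ} (y : E n) : MvPolynomial (Fin n) ℝ := C (‖y‖ ^ 2) * ∑ i, X i ^ 2

/-- The zonal harmonic polynomial of degree `k` with pole `y`. -/
def zonal {n : ℕ} (l : ℝ) (y : E n) (k : ℕ) : MvPolynomial (Fin n) ℝ :=
  gegenbauer l (linForm y) (quadForm y) k

theorem zonal_isHomogeneous {n : ℕ} (l : ℝ) (y : E n) (k : ℕ) :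
    (zonal l y k).IsHomogeneous k := by
  have hs : (linForm y).IsHomogeneous 1 := by
    refine IsHomogeneous.sum _ _ _ fun i _ => ?_
    have := (isHomogeneous_C (Fin n) (y i)).mul (isHomogeneous_X ℝ i)
    rwa [zero_add] at this
  have hq : (quadForm y).IsHomogeneous 2 := by
    have h : (∑ i : Fin n, (X i : MvPolynomial (Fin n) ℝ) ^ 2).IsHomogeneous 2 :=
      IsHomogeneous.sum _ _ _ fun i _ => isHomogeneous_X_pow i 2
    have := (isHomogeneous_C (Fin n) (‖y‖ ^ 2)).mul h
    rwa [zero_add] at this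
  have hsmul : ∀ (a : ℝ) (p : MvPolynomial (Fin n) ℝ) (m : ℕ), p.IsHomogeneous m →
      (a • p).IsHomogeneous m := fun a p m hp => by
    have := (isHomogeneous_C (Fin n) a).mul hp
    rwa [zero_add, ← smul_eq_C_mul] at this
  induction k using Nat.twoStepInduction with
  | zero => exact isHomogeneous_one _ _
  | one => exact hsmul _ _ _ hs
  | more k h0 h1 =>
    refine hsmul _ _ _ (IsHomogeneous.sub (hsmul _ _ _ ?_) (hsmul _ _ _ ?_))
    · have := hs.mul h1
      rwa [show 1 + (k + 1) = k + 2 by ring] at this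
    · have := hq.mul h0
      rwa [show 2 + k = k + 2 by ring] at this

theorem pderiv_linForm {n : ℕ} (y : E n) (i : Fin n) : pderiv i (linForm y) = C (y i) := by
  simp [linForm, pderiv_X, Pi.single_apply]

theorem pderiv_quadForm {n : ℕ} (y : E n) (i : Fin n) :
    pderiv i (quadForm y) = C (‖y‖ ^ 2) * (2 * X i) := by
  simp only [quadForm, pderiv_C_mul, map_sum, pderiv_pow, pderiv_X]
  simp [Pi.single_apply]

theorem sum_sq_C {n : ℕ} (y : E n) :
    ∑ i, (C (y i) * C (y i) : MvPolynomial (Fin n) ℝ) = C (‖y‖ ^ 2) := by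
  rw [EuclideanSpace.real_norm_sq_eq, map_sum]
  simp [sq]

theorem polyLap_linForm_mul {n : ℕ} (y : E n) (p : MvPolynomial (Fin n) ℝ) :
    polyLap n (linForm y * p) = linForm y * polyLap n p + 2 * ∑ i, C (y i) * pderiv i p := by
  simp only [polyLap, pderiv_mul, map_add, pderiv_linForm, pderiv_C, Finset.mul_sum]
  rw [← Finset.sum_add_distrib]
  exact Finset.sum_congr rfl fun i _ => by ring

theorem polyLap_quadForm_mul {n : ℕ} (y : E n) (p : MvPolynomial (Fin n) ℝ) {k : ℕ}
    (hp : p.IsHomogeneous k) :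
    polyLap n (quadForm y * p) = quadForm y * polyLap n p
      + C (‖y‖ ^ 2) *
          ((2 * (n : MvPolynomial (Fin n) ℝ) + 4 * (k : MvPolynomial (Fin n) ℝ)) * p) := by
  have heul := hp.sum_X_mul_pderiv
  have h2 : ∀ i, pderiv i (2 * X i : MvPolynomial (Fin n) ℝ) = 2 := fun i => by
    have : (2 : MvPolynomial (Fin n) ℝ) = C 2 := (map_ofNat C 2).symm
    rw [this, pderiv_C_mul]; simp
  have : polyLap n (quadForm y * p) = quadForm y * polyLap n p
      + C (‖y‖ ^ 2) * (2 * (n : MvPolynomial (Fin n) ℝ) * p + 4 * ∑ i, X i * pderiv i p) := by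
    have hn : 2 * (n : MvPolynomial (Fin n) ℝ) * p = ∑ _i : Fin n, 2 * p := by
      simp; ring
    simp only [polyLap, pderiv_mul, map_add, pderiv_quadForm, pderiv_C, h2, hn, Finset.mul_sum,
      mul_add]
    rw [← Finset.sum_add_distrib, ← Finset.sum_add_distrib]
    exact Finset.sum_congr rfl fun i _ => by ring
  rw [this, heul, nsmul_eq_mul]
  ring

theorem polyLap_smul {n : ℕ} (a : ℝ) (p : MvPolynomial (Fin n) ℝ) :
    polyLap n (a • p) = a • polyLap n p := by
  simp [polyLap, Finset.smul_sum]

theorem polyLap_sub {n : ℕ} (p q : MvPolynomial (Fin n) ℝ) :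
    polyLap n (p - q) = polyLap n p - polyLap n q := by
  simp [polyLap]

theorem zonal_recurrence {n : ℕ} (l : ℝ) (y : E n) (k : ℕ) :
    ((k : ℝ) + 2) • zonal l y (k + 2) =
        (2 * ((k : ℝ) + 1) + 2 * l) • (linForm y * zonal l y (k + 1))
      - ((k : ℝ) + 2 * l) • (quadForm y * zonal l y k) := by
  simp only [zonal, gegenbauer]
  rw [smul_smul, mul_inv_cancel₀ (by positivity), one_smul]

/-- The derivative of a zonal polynomial in the direction of its pole. -/
theorem dirDeriv_zonal {n : ℕ} (l : ℝ) (y : E n) (k : ℕ) :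
    ∑ i, C (y i) * pderiv i (zonal l y (k + 1))
      = ((k : ℝ) + 2 * l) • (C (‖y‖ ^ 2) * zonal l y k) := by
  set D : MvPolynomial (Fin n) ℝ → MvPolynomial (Fin n) ℝ :=
    fun p => ∑ i, C (y i) * pderiv i p with hD
  have hDsmul : ∀ (a : ℝ) p, D (a • p) = a • D p := fun a p => by
    simp [hD, Finset.smul_sum]
  have hDsub : ∀ p q, D (p - q) = D p - D q := fun p q => by
    simp [hD, mul_sub]
  have hDs : ∀ p, D (linForm y * p) = C (‖y‖ ^ 2) * p + linForm y * D p := fun p => by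
    simp only [hD, pderiv_mul, pderiv_linForm, ← sum_sq_C, Finset.sum_mul, Finset.mul_sum]
    rw [← Finset.sum_add_distrib]
    exact Finset.sum_congr rfl fun i _ => by ring
  have hDq : ∀ p, D (quadForm y * p) = 2 * C (‖y‖ ^ 2) * linForm y * p + quadForm y * D p :=
    fun p => by
    simp only [hD, pderiv_mul, pderiv_quadForm, Finset.mul_sum]
    simp only [linForm, Finset.mul_sum, Finset.sum_mul]
    rw [← Finset.sum_add_distrib]
    exact Finset.sum_congr rfl fun i _ => by ring
  change D (zonal l y (k + 1)) = _
  have h1 : D 1 = 0 := by simp [hD]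
  induction k using Nat.twoStepInduction with
  | zero =>
    have : zonal l y 1 = (2 * l) • (linForm y * 1) := by simp [zonal, gegenbauer]
    rw [this, hDsmul, hDs, h1]; simp [zonal, gegenbauer]
  | one =>
    have hr := zonal_recurrence l y 0
    have h0 : zonal l y 0 = 1 := rfl
    have hz1 : zonal l y 1 = (2 * l) • (linForm y * 1) := by simp [zonal, gegenbauer]
    have hh := congrArg D hr
    rw [hDsmul, hDsub, hDsmul, hDsmul, hDs, hDq, h0, h1, hz1, hDsmul, hDs, h1] at hh
    rw [hz1]
    simp only [smul_eq_C_mul, map_add, map_mul, Nat.cast_zero, zero_add, Nat.cast_one,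
      map_ofNat, map_one] at hh ⊢
    have h2 : (2 : MvPolynomial (Fin n) ℝ) ≠ 0 := two_ne_zero
    refine mul_left_cancel₀ h2 ?_
    linear_combination hh
  | more k ih0 ih1 =>
    have hr := zonal_recurrence l y (k + 1)
    have hr0 := zonal_recurrence l y k
    have hh := congrArg D hr
    rw [hDsmul, hDsub, hDsmul, hDsmul, hDs, hDq, ih0, ih1] at hh
    have hk : ((k : MvPolynomial (Fin n) ℝ) + 3) ≠ 0 := by
      have : ((k + 3 : ℕ) : MvPolynomial (Fin n) ℝ) ≠ 0 := Nat.cast_ne_zero.2 (by omega)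
      simpa using this
    refine mul_left_cancel₀ hk ?_
    simp only [smul_eq_C_mul, map_add, map_mul, map_natCast, Nat.cast_add,
      Nat.cast_one, map_ofNat, map_one, Nat.cast_ofNat] at hh hr0 ⊢
    linear_combination hh - (k + 1 + 2 * C l) * C (‖y‖ ^ 2) * hr0

theorem polyLap_zonal {n : ℕ} (l : ℝ) (hl : 2 * l + 2 = n) (y : E n) (k : ℕ) :
    polyLap n (zonal l y k) = 0 := by
  have h1 : polyLap n 1 = 0 := by simp [polyLap]
  induction k using Nat.twoStepInduction with
  | zero => exact h1
  | one =>
    have hz1 : zonal l y 1 = (2 * l) • (linForm y * 1) := by simp [zonal, gegenbauer]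
    rw [hz1, polyLap_smul, polyLap_linForm_mul, h1]; simp
  | more k ih0 ih1 =>
    have hh := congrArg (polyLap n) (zonal_recurrence l y k)
    rw [polyLap_smul, polyLap_sub, polyLap_smul, polyLap_smul, polyLap_linForm_mul,
      polyLap_quadForm_mul y _ (zonal_isHomogeneous l y k), ih0, ih1, dirDeriv_zonal] at hh
    have hn : (n : MvPolynomial (Fin n) ℝ) = 2 * C l + 2 := by
      have := congrArg (C : ℝ → MvPolynomial (Fin n) ℝ) hl
      rw [map_add, map_mul, map_natCast, map_ofNat] at this
      exact this.symm
    rw [hn] at hh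
    have hk : ((k : ℝ) + 2) ≠ 0 := by positivity
    refine smul_right_injective _ hk ?_
    simp only [smul_zero]
    rw [hh]
    simp only [smul_eq_C_mul, map_add, map_mul, map_natCast, map_ofNat, map_one]
    ring

theorem eval_zonal {n : ℕ} (l : ℝ) (x y : E n) (k : ℕ) :
    eval (fun i => x i) (zonal l y k) = gegenbauer l (inner ℝ x y) (‖x‖ ^ 2 * ‖y‖ ^ 2) k := by
  have := map_gegenbauer (aeval (fun i => x i) : MvPolynomial (Fin n) ℝ →ₐ[ℝ] ℝ) l
    (linForm y) (quadForm y) k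
  simp only [aeval_eq_eval] at this
  rw [zonal]
  refine this.trans ?_
  congr 1
  · simp [linForm, PiLp.inner_apply]
  · simp [quadForm, EuclideanSpace.real_norm_sq_eq x, mul_comm]

theorem gegenbauer_inner {n : ℕ} (l : ℝ) (x y : E n) (k : ℕ) :
    gegenbauer l (inner ℝ x y) (‖x‖ ^ 2 * ‖y‖ ^ 2) k
      = (‖x‖ * ‖y‖) ^ k * gegenbauer l (inner ℝ x y / (‖x‖ * ‖y‖)) 1 k := by
  rw [← gegenbauer_scale]
  by_cases h : ‖x‖ * ‖y‖ = 0
  · have : inner ℝ x y = 0 := by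
      rcases mul_eq_zero.1 h with h | h <;> simp [norm_eq_zero.1 h]
    rw [h, this]; congr 1 <;> simp [← mul_pow, h]
  · congr 1
    · rw [mul_div_cancel₀ _ h]
    · ring

end GegenbauerPolynomial

section GegenbauerCoefficients

open MvPolynomial MeasureTheory

theorem exists_hasFDerivAt_eval {n : ℕ} (p : MvPolynomial (Fin n) ℝ) (x : E n) :
    ∃ L : E n →L[ℝ] ℝ, HasFDerivAt (fun z : E n => eval (fun i => z i) p) L x ∧
      ∀ i, L (EuclideanSpace.single i 1) = eval (fun i => x i) (pderiv i p) := by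
  induction p using MvPolynomial.induction_on with
  | C a => exact ⟨0, by simpa using hasFDerivAt_const a x, by simp⟩
  | add p q hp hq =>
    obtain ⟨L, hL, hL'⟩ := hp
    obtain ⟨M, hM, hM'⟩ := hq
    exact ⟨L + M, by simpa using hL.fun_add hM, by simp [hL', hM']⟩
  | mul_X p j hp =>
    obtain ⟨L, hL, hL'⟩ := hp
    have hX : HasFDerivAt (fun z : E n => z j) (EuclideanSpace.proj j : E n →L[ℝ] ℝ) x :=
      (EuclideanSpace.proj j : E n →L[ℝ] ℝ).hasFDerivAt
    refine ⟨_, by simpa using hL.fun_mul hX, fun i => ?_⟩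
    simp only [add_apply, smul_apply, hL', pderiv_mul,
      pderiv_X, map_add, map_mul, eval_X, smul_eq_mul]
    by_cases hij : i = j
    · subst hij; simp; ring
    · simp [Ne.symm hij, mul_comm]

theorem fderiv_eval {n : ℕ} (p : MvPolynomial (Fin n) ℝ) (x : E n) (i : Fin n) :
    fderiv ℝ (fun z : E n => eval (fun i => z i) p) x (EuclideanSpace.single i 1)
      = eval (fun i => x i) (pderiv i p) := by
  obtain ⟨L, hL, h⟩ := exists_hasFDerivAt_eval p x
  rw [hL.fderiv, h]

theorem lap_eval {n : ℕ} (p : MvPolynomial (Fin n) ℝ) (x : E n) :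
    lap n (fun z : E n => eval (fun i => z i) p) x = eval (fun i => x i) (polyLap n p) := by
  simp [lap, fderiv_eval, polyLap]

/-- A family of polynomials whose coefficients are continuous and of growth at most `‖y‖ ^ k`. -/
def CoeffGrowth {n : ℕ} (k : ℕ) (P : E n → MvPolynomial (Fin n) ℝ) : Prop :=
  ∀ m, Continuous (fun y => coeff m (P y)) ∧ ∃ C, 0 ≤ C ∧ ∀ y, |coeff m (P y)| ≤ C * ‖y‖ ^ k

namespace CoeffGrowth
variable {n k k' : ℕ} {P Q : E n → MvPolynomial (Fin n) ℝ}

theorem sub (hP : CoeffGrowth k P) (hQ : CoeffGrowth k Q) :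
    CoeffGrowth k (fun y => P y - Q y) := fun m => by
  obtain ⟨h1, C1, hC1, hb1⟩ := hP m
  obtain ⟨h2, C2, hC2, hb2⟩ := hQ m
  refine ⟨by simpa using h1.fun_sub h2, C1 + C2, by positivity, fun y => ?_⟩
  rw [coeff_sub]
  linarith [abs_sub (coeff m (P y)) (coeff m (Q y)), hb1 y, hb2 y]

theorem sum {ι : Type*} (s : Finset ι) {P : ι → E n → MvPolynomial (Fin n) ℝ}
    (hP : ∀ i ∈ s, CoeffGrowth k (P i)) :
    CoeffGrowth k (fun y => ∑ i ∈ s, P i y) := fun m => by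
  have h : ∀ i, ∃ C, i ∈ s → 0 ≤ C ∧ ∀ y, |coeff m (P i y)| ≤ C * ‖y‖ ^ k := fun i => by
    by_cases hi : i ∈ s
    · obtain ⟨_, C, hC⟩ := hP i hi m
      exact ⟨C, fun _ => hC⟩
    · exact ⟨0, fun h => absurd h hi⟩
  choose C hC using h
  simp only [coeff_sum]
  refine ⟨continuous_finsetSum _ fun i hi => (hP i hi m).1, ∑ i ∈ s, C i,
    Finset.sum_nonneg fun i hi => (hC i hi).1, fun y => ?_⟩
  rw [Finset.sum_mul]
  exact (Finset.abs_sum_le_sum_abs _ _).trans (Finset.sum_le_sum fun i hi => (hC i hi).2 y)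

theorem mul (hP : CoeffGrowth k P) (hQ : CoeffGrowth k' Q) :
    CoeffGrowth (k + k') (fun y => P y * Q y) := fun m => by
  have h : ∀ a : Fin n →₀ ℕ, ∃ C, 0 ≤ C ∧ ∀ y, |coeff a (P y)| ≤ C * ‖y‖ ^ k :=
    fun a => (hP a).2
  have h' : ∀ a : Fin n →₀ ℕ, ∃ C, 0 ≤ C ∧ ∀ y, |coeff a (Q y)| ≤ C * ‖y‖ ^ k' :=
    fun a => (hQ a).2
  choose C hC hb using h
  choose C' hC' hb' using h'
  simp only [coeff_mul]
  refine ⟨continuous_finsetSum _ fun a _ => (hP a.1).1.mul (hQ a.2).1,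
    ∑ a ∈ Finset.HasAntidiagonal.antidiagonal m, C a.1 * C' a.2,
    Finset.sum_nonneg fun a _ => mul_nonneg (hC _) (hC' _), fun y => ?_⟩
  rw [Finset.sum_mul]
  refine (Finset.abs_sum_le_sum_abs _ _).trans (Finset.sum_le_sum fun a _ => ?_)
  rw [abs_mul]
  calc _ ≤ (C a.1 * ‖y‖ ^ k) * (C' a.2 * ‖y‖ ^ k') := by
        gcongr
        · exact mul_nonneg (hC _) (by positivity)
        · exact hb _ _
        · exact hb' _ _
    _ = _ := by ring

theorem const (p : MvPolynomial (Fin n) ℝ) : CoeffGrowth 0 (fun _ : E n => p) := fun m =>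
  ⟨continuous_const, |coeff m p|, abs_nonneg _, fun y => by simp⟩

theorem smul (a : ℝ) (hP : CoeffGrowth k P) : CoeffGrowth k (fun y => a • P y) := by
  have := (const (n := n) (C a)).mul hP
  simpa [smul_eq_C_mul] using this

theorem coord (i : Fin n) : CoeffGrowth 1 (fun y : E n => (C (y i) : MvPolynomial (Fin n) ℝ)) :=
  fun m => by
  simp only [coeff_C]
  split_ifs with h
  · refine ⟨by fun_prop, 1, by simp, fun y => ?_⟩
    simpa using PiLp.norm_apply_le y i
  · exact ⟨continuous_const, 0, le_rfl, by simp⟩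

theorem linForm : CoeffGrowth 1 (fun y : E n => linForm y) :=
  CoeffGrowth.sum _ fun i _ => (coord i).mul (const (X i))

theorem quadForm : CoeffGrowth 2 (fun y : E n => quadForm y) := by
  have : CoeffGrowth 2 (fun y : E n => (C (‖y‖ ^ 2) : MvPolynomial (Fin n) ℝ)) := by
    simp only [← sum_sq_C]
    exact CoeffGrowth.sum _ fun i _ => (coord i).mul (coord i)
  exact this.mul (const _)

theorem zonal (l : ℝ) (k : ℕ) : CoeffGrowth k (fun y : E n => zonal l y k) := by
  induction k using Nat.twoStepInduction with
  | zero => exact const 1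
  | one => exact linForm.smul _
  | more k h0 h1 =>
    refine CoeffGrowth.smul _ (CoeffGrowth.sub (CoeffGrowth.smul _ ?_) (CoeffGrowth.smul _ ?_))
    · have := linForm.mul h1
      rwa [show 1 + (k + 1) = k + 2 by ring] at this
    · have := quadForm.mul h0
      rwa [show 2 + k = k + 2 by ring] at this

end CoeffGrowth

/-- The moment of `f` against the zonal polynomials of degree `k`. -/
def zonalMoment {n : ℕ} (l : ℝ) (f : E n → ℝ) (k : ℕ) : MvPolynomial (Fin n) ℝ :=
  ∑ m ∈ Finset.finsuppAntidiag Finset.univ k, monomial m (∫ y, coeff m (zonal l y k) * f y)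

theorem integrable_coeff_zonal {n : ℕ} (l : ℝ) {f : E n → ℝ} {k : ℕ} (hf : Continuous f)
    (hint : Integrable (fun y => ‖y‖ ^ k * f y)) (m : Fin n →₀ ℕ) :
    Integrable (fun y => coeff m (zonal l y k) * f y) := by
  obtain ⟨hc, C, hC, hb⟩ := CoeffGrowth.zonal l k m (n := n)
  refine (hint.const_mul C).mono (hc.mul hf).aestronglyMeasurable (.of_forall fun y => ?_)
  simp only [norm_mul, Real.norm_eq_abs, abs_norm, abs_pow]
  rw [← mul_assoc, abs_of_nonneg hC]
  gcongr
  exact hb y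

theorem sum_coeff_zonal {n : ℕ} (l : ℝ) (y : E n) (k : ℕ) :
    ∑ m ∈ Finset.finsuppAntidiag Finset.univ k, monomial m (coeff m (zonal l y k))
      = zonal l y k := by
  conv_rhs => rw [(zonal l y k).as_sum]
  refine (Finset.sum_subset (fun m hm => ?_) fun m _ hm => ?_).symm
  · have := zonal_isHomogeneous l y k (mem_support_iff.1 hm)
    rw [Finset.mem_finsuppAntidiag]
    refine ⟨?_, Finset.subset_univ _⟩
    rw [← this, Finsupp.weight_apply, Finsupp.sum_fintype] <;> simp
  · rw [notMem_support_iff.1 hm, monomial_zero]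

theorem apply_zonalMoment {n : ℕ} (l : ℝ) {f : E n → ℝ} {k : ℕ} (hf : Continuous f)
    (hint : Integrable (fun y => ‖y‖ ^ k * f y)) (T : MvPolynomial (Fin n) ℝ →ₗ[ℝ] ℝ) :
    T (zonalMoment l f k) = ∫ y, T (zonal l y k) * f y := by
  have hmon : ∀ m (a : ℝ), T (monomial m a) = a * T (monomial m 1) := fun m a => by
    rw [← smul_eq_mul, ← map_smul, smul_monomial]; simp
  rw [zonalMoment, map_sum]
  simp only [hmon _ (∫ _, _)]
  simp only [← integral_mul_const]
  rw [← integral_finsetSum _ fun m _ => (integrable_coeff_zonal l hf hint m).mul_const _]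
  refine integral_congr_ae (.of_forall fun y => ?_)
  simp only
  conv_rhs => rw [← sum_coeff_zonal l y k, map_sum]
  rw [Finset.sum_mul]
  refine Finset.sum_congr rfl fun m _ => ?_
  rw [hmon m (coeff m _)]; ring

theorem eval_zonalMoment {n : ℕ} (l : ℝ) {f : E n → ℝ} {k : ℕ} (hf : Continuous f)
    (hint : Integrable (fun y => ‖y‖ ^ k * f y)) (x : E n) :
    eval (fun i => x i) (zonalMoment l f k)
      = ∫ y, gegenbauer l (inner ℝ x y) (‖x‖ ^ 2 * ‖y‖ ^ 2) k * f y := by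
  have := apply_zonalMoment l hf hint (aeval (fun i => x i)).toLinearMap
  simp only [AlgHom.toLinearMap_apply, aeval_eq_eval] at this
  simp only [← eval_zonal]
  exact this

theorem isHHP_zonalMoment {n : ℕ} {l : ℝ} (hl : 2 * l + 2 = n) {f : E n → ℝ} {k : ℕ}
    (hf : Continuous f) (hint : Integrable (fun y => ‖y‖ ^ k * f y)) (a : ℝ) :
    IsHHP n k (fun x => a * eval (fun i => x i) (zonalMoment l f k)) := by
  refine ⟨⟨C a * zonalMoment l f k, fun x => by simp⟩, fun c x => ?_, fun x => ?_⟩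
  · beta_reduce
    rw [eval_zonalMoment l hf hint, eval_zonalMoment l hf hint]
    have : ∀ y, gegenbauer l (inner ℝ (c • x) y) (‖c • x‖ ^ 2 * ‖y‖ ^ 2) k
        = c ^ k * gegenbauer l (inner ℝ x y) (‖x‖ ^ 2 * ‖y‖ ^ 2) k := fun y => by
      rw [← gegenbauer_scale, real_inner_smul_left, norm_smul, mul_pow]
      simp [mul_assoc]
    simp only [this, mul_assoc, integral_const_mul]
    ring
  · have : (fun x : E n => a * eval (fun i => x i) (zonalMoment l f k))
        = fun x : E n => eval (fun i => x i) (C a * zonalMoment l f k) := by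
      funext x; simp
    rw [this, lap_eval, ← smul_eq_C_mul, polyLap_smul, smul_eval]
    have := apply_zonalMoment l hf hint ((aeval (fun i => x i)).toLinearMap ∘ₗ
      ∑ i, (pderiv i).toLinearMap ∘ₗ (pderiv i : Derivation ℝ _ _).toLinearMap)
    have h2 : ∀ p, ((aeval (fun i => x i)).toLinearMap ∘ₗ
      ∑ i, (pderiv i).toLinearMap ∘ₗ (pderiv i : Derivation ℝ _ _).toLinearMap) p
        = eval (fun i => x i) (polyLap n p) := fun p => by
      simp [polyLap, aeval_eq_eval]
    simp only [h2, polyLap_zonal l hl] at this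
    rw [this]; simp

end GegenbauerCoefficients

section Convolution

open MeasureTheory

/-- The truncation to the ball of radius `ρ` of the singular kernel `‖z‖ ^ (-2 l)`. -/
def singularPart {n : ℕ} (l ρ : ℝ) : E n → ℝ :=
  (Metric.ball (0 : E n) ρ).indicator fun z => ‖z‖ ^ (-(2 * l))

theorem singularPart_nonneg {n : ℕ} (l ρ : ℝ) (z : E n) : 0 ≤ singularPart l ρ z :=
  Set.indicator_nonneg (fun _ _ => by positivity) _

theorem norm_sub_rpow_eq {n : ℕ} (l : ℝ) {x : E n} (hx : x ≠ 0) (y : E n) :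
    ‖x - y‖ ^ (-(2 * l)) = ‖x‖ ^ (-(2 * l)) *
      (1 - 2 * (inner ℝ x y / (‖x‖ * ‖y‖)) * (‖y‖ / ‖x‖) + (‖y‖ / ‖x‖) ^ 2) ^ (-l) := by
  have h1 : ∀ a : ℝ, 0 ≤ a → a ^ (-(2 * l)) = (a ^ 2) ^ (-l) := fun a ha => by
    rw [← Real.rpow_natCast, ← Real.rpow_mul ha]; congr 1; push_cast; ring
  have h2 : ‖x - y‖ ^ 2 = ‖x‖ ^ 2 *
      (1 - 2 * (inner ℝ x y / (‖x‖ * ‖y‖)) * (‖y‖ / ‖x‖) + (‖y‖ / ‖x‖) ^ 2) := by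
    rw [norm_sub_sq_real]
    by_cases hy : y = 0
    · simp [hy]
    · have : 0 < ‖y‖ := norm_pos_iff.2 hy
      field_simp
  rw [h1 _ (norm_nonneg _), h1 _ (norm_nonneg _), h2, Real.mul_rpow (by positivity)]
  refine nonneg_of_mul_nonneg_right (a := ‖x‖ ^ 2) ?_ (by positivity)
  rw [← h2]; positivity

theorem zonal_term_eq {n : ℕ} (l : ℝ) {x : E n} (hx : x ≠ 0) (y : E n) (k : ℕ) :
    ‖x‖ ^ (-(2 * l) - 2 * k) * gegenbauer l (inner ℝ x y) (‖x‖ ^ 2 * ‖y‖ ^ 2) k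
      = ‖x‖ ^ (-(2 * l)) * (gegenbauer l (inner ℝ x y / (‖x‖ * ‖y‖)) 1 k * (‖y‖ / ‖x‖) ^ k) := by
  have hx' : 0 < ‖x‖ := norm_pos_iff.2 hx
  rw [gegenbauer_inner, Real.rpow_sub hx', mul_pow, div_pow]
  have : ‖x‖ ^ (2 * (k : ℝ)) = ‖x‖ ^ k * ‖x‖ ^ k := by
    rw [← pow_add, ← Real.rpow_natCast]; push_cast; ring_nf
  rw [this]
  field_simp

theorem abs_inner_div_le {n : ℕ} (x y : E n) : |inner ℝ x y / (‖x‖ * ‖y‖)| ≤ 1 :=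
  abs_real_inner_div_norm_mul_norm_le_one x y

/-- Zonal harmonic expansion of the kernel, with remainder. -/
theorem kernel_expansion {l : ℝ} (hl : 1 ≤ l) (N : ℕ) {β : ℝ} (hβ : N ≤ β)
    (hβ' : β ≤ N + 1) :
    ∃ C, 0 ≤ C ∧ ∀ (n : ℕ) (x y : E n), x ≠ 0 →
      |‖x - y‖ ^ (-(2 * l)) - ∑ k ∈ Finset.range (N + 1), ‖x‖ ^ (-(2 * l) - 2 * k) *
        gegenbauer l (inner ℝ x y) (‖x‖ ^ 2 * ‖y‖ ^ 2) k|
      ≤ C * (‖x‖ ^ (-(2 * l) - β) * ‖y‖ ^ β) + singularPart l (‖x‖ / 2) (x - y) := by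
  obtain ⟨M, hM, hrem⟩ := gegenbauer_remainder l hl N
  choose B hB hbd using gegenbauer_bound l
  have hβ0 : 0 ≤ β := le_trans (by positivity) hβ
  refine ⟨M + (∑ k ∈ Finset.range (N + 1), B k * 2 ^ β) + 4 ^ l * 2 ^ β, ?_, fun n x y hx => ?_⟩
  · have : 0 ≤ ∑ k ∈ Finset.range (N + 1), B k * (2 : ℝ) ^ β :=
      Finset.sum_nonneg fun k _ => mul_nonneg (hB k) (by positivity)
    positivity
  have hx' : 0 < ‖x‖ := norm_pos_iff.2 hx
  simp only [zonal_term_eq l hx y, ← Finset.mul_sum]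
  have hc := abs_inner_div_le x y
  set c := inner ℝ x y / (‖x‖ * ‖y‖) with hcdef
  set t := ‖y‖ / ‖x‖ with ht
  have ht0 : 0 ≤ t := by positivity
  have hSnn : 0 ≤ ∑ k ∈ Finset.range (N + 1), B k * (2 : ℝ) ^ β :=
    Finset.sum_nonneg fun k _ => mul_nonneg (hB k) (by positivity)
  have hrhs : ‖x‖ ^ (-(2 * l) - β) * ‖y‖ ^ β = ‖x‖ ^ (-(2 * l)) * t ^ β := by
    rw [ht, Real.div_rpow (norm_nonneg _) (norm_nonneg _), Real.rpow_sub hx']; field_simp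
  rw [hrhs]
  have hsing := singularPart_nonneg l (‖x‖ / 2) (x - y)
  rcases le_or_gt t (1 / 2) with h | h
  · have h1 := hrem c t hc ht0 h
    have h2 : t ^ (N + 1) ≤ t ^ β := by
      rcases ht0.eq_or_lt with h0 | h0
      · rw [← h0]; simp; positivity
      · rw [← Real.rpow_natCast]
        exact Real.rpow_le_rpow_of_exponent_ge h0 (by linarith) (by push_cast; linarith)
    rw [norm_sub_rpow_eq l hx y, ← mul_sub, abs_mul, abs_of_nonneg (by positivity)]
    calc _ ≤ ‖x‖ ^ (-(2 * l)) * (M * t ^ β) := by gcongr; exact h1.trans (by gcongr)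
      _ = M * (‖x‖ ^ (-(2 * l)) * t ^ β) := by ring
      _ ≤ (M + (∑ k ∈ Finset.range (N + 1), B k * 2 ^ β) + 4 ^ l * 2 ^ β)
            * (‖x‖ ^ (-(2 * l)) * t ^ β) := by
          gcongr; have : (0 : ℝ) ≤ 4 ^ l * 2 ^ β := by positivity
          linarith
      _ ≤ _ := by linarith
  · have htp : 0 < t := by linarith
    have hsum : |∑ k ∈ Finset.range (N + 1), gegenbauer l c 1 k * t ^ k|
        ≤ (∑ k ∈ Finset.range (N + 1), B k * 2 ^ β) * t ^ β := by
      rw [Finset.sum_mul]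
      refine (Finset.abs_sum_le_sum_abs _ _).trans (Finset.sum_le_sum fun k hk => ?_)
      rw [abs_mul, abs_of_nonneg (pow_nonneg ht0 k), mul_assoc]
      have hkβ : (k : ℝ) ≤ β := by
        have : (k : ℝ) ≤ N := by exact_mod_cast Nat.lt_succ_iff.1 (Finset.mem_range.1 hk)
        linarith
      have : t ^ k ≤ 2 ^ β * t ^ β := by
        rw [← Real.mul_rpow (by norm_num) ht0]
        calc t ^ k ≤ (2 * t) ^ k := by gcongr; linarith
          _ = (2 * t) ^ (k : ℝ) := (Real.rpow_natCast _ _).symm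
          _ ≤ _ := Real.rpow_le_rpow_of_exponent_le (by linarith) hkβ
      gcongr
      · exact hB k
      · exact hbd k c 1 hc (by simp)
    have hker : ‖x - y‖ ^ (-(2 * l)) ≤ ‖x‖ ^ (-(2 * l)) * (4 ^ l * 2 ^ β * t ^ β)
        + singularPart l (‖x‖ / 2) (x - y) := by
      by_cases hz : x - y ∈ Metric.ball (0 : E n) (‖x‖ / 2)
      · rw [singularPart, Set.indicator_of_mem hz]
        have : 0 ≤ ‖x‖ ^ (-(2 * l)) * (4 ^ l * 2 ^ β * t ^ β) := by positivity
        linarith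
      · rw [singularPart, Set.indicator_of_notMem hz, add_zero]
        rw [mem_ball_zero_iff, not_lt] at hz
        calc ‖x - y‖ ^ (-(2 * l)) ≤ (‖x‖ / 2) ^ (-(2 * l)) :=
              Real.rpow_le_rpow_of_nonpos (by positivity) hz (by linarith)
          _ = ‖x‖ ^ (-(2 * l)) * 4 ^ l := by
              rw [Real.div_rpow hx'.le (by norm_num), Real.rpow_neg (by norm_num : (0:ℝ) ≤ 2),
                Real.rpow_mul (by norm_num)]
              norm_num
          _ ≤ ‖x‖ ^ (-(2 * l)) * (4 ^ l * 2 ^ β * t ^ β) := by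
              gcongr
              rw [mul_assoc, ← Real.mul_rpow (by norm_num) ht0]
              exact le_mul_of_one_le_right (by positivity)
                (Real.one_le_rpow (by linarith) hβ0)
    refine (abs_sub _ _).trans ?_
    rw [abs_mul, abs_of_nonneg (by positivity : 0 ≤ ‖x - y‖ ^ (-(2 * l))),
      abs_of_nonneg (by positivity : 0 ≤ ‖x‖ ^ (-(2 * l)))]
    have hs2 := mul_le_mul_of_nonneg_left hsum (by positivity : 0 ≤ ‖x‖ ^ (-(2 * l)))
    have hM2 : 0 ≤ M * (‖x‖ ^ (-(2 * l)) * t ^ β) := by positivity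
    linarith

variable {n : ℕ} {l : ℝ}

theorem integrable_singularPart (hn : 2 ≤ n) (hl : 2 * l < n) (ρ : ℝ) :
    Integrable (singularPart l ρ : E n → ℝ) := by
  rw [singularPart, integrable_indicator_iff measurableSet_ball]
  refine integrableOn_ball_of_norm_le_rpow (C := 1) (α := 2 * l) (by simp; omega)
      (by simpa using hl)
    (.of_forall fun x => ?_) ?_
  · rw [one_mul, Real.norm_of_nonneg (by positivity)]
  · exact (by fun_prop : Measurable fun z : E n => ‖z‖ ^ (-(2 * l))).aestronglyMeasurable

theorem integral_singularPart (hl : 2 * l + 2 = n) {ρ : ℝ} (hρ : 0 < ρ) :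
    ∫ z : E n, singularPart l ρ z = ρ ^ 2 * ∫ z : E n, singularPart l 1 z := by
  simp only [singularPart, integral_indicator measurableSet_ball]
  have h := Measure.setIntegral_comp_smul_of_pos (volume : Measure (E n))
    (fun z => ‖z‖ ^ (-(2 * l))) (Metric.ball 0 1) hρ
  rw [smul_unitBall_of_pos hρ] at h
  simp only [norm_smul, Real.norm_of_nonneg hρ.le,
    Real.mul_rpow hρ.le (norm_nonneg _), integral_const_mul, smul_eq_mul, finrank_euclideanSpace,
    Fintype.card_fin] at h
  have h2 : ρ ^ n = ρ ^ (2 * l) * ρ ^ 2 := by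
    rw [← Real.rpow_natCast, ← hl, Real.rpow_add hρ]; simp
  rw [h2, Real.rpow_neg hρ.le] at h
  have : ρ ^ (2 * l) ≠ 0 := by positivity
  field_simp at h
  exact h.symm.trans (mul_comm _ _)

theorem integrable_rpow_mul_of_decay {f : E n → ℝ} (hf : Continuous f) {A a : ℝ}
    (hA : ∀ y, |f y| ≤ A * (1 + ‖y‖) ^ (-a)) {b : ℝ} (hb : 0 ≤ b) (hb' : b + n < a) :
    Integrable (fun y => ‖y‖ ^ b * f y) := by
  have hi : Integrable (fun y : E n => (1 + ‖y‖) ^ (-(a - b))) :=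
    integrable_one_add_norm (by simp; linarith)
  refine (hi.const_mul A).mono' ?_ (.of_forall fun y => ?_)
  · exact ((continuous_norm.rpow_const fun _ => Or.inr hb).mul hf).aestronglyMeasurable
  · have h1 : (0 : ℝ) < 1 + ‖y‖ := by positivity
    rw [norm_mul, Real.norm_of_nonneg (by positivity), Real.norm_eq_abs]
    calc ‖y‖ ^ b * |f y| ≤ (1 + ‖y‖) ^ b * (A * (1 + ‖y‖) ^ (-a)) := by
          gcongr
          · linarith
          · exact hA y
      _ = A * ((1 + ‖y‖) ^ b * (1 + ‖y‖) ^ (-a)) := by ring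
      _ = _ := by rw [← Real.rpow_add h1]; ring_nf

theorem integrable_kernel_mul (hl : 2 * l + 2 = n) (hl0 : 0 ≤ l) {f : E n → ℝ}
    (hf : Continuous f) (hfi : Integrable f) {A : ℝ} (hA : ∀ y, |f y| ≤ A) (x : E n) :
    Integrable (fun y => ‖x - y‖ ^ (-(2 * l)) * f y) := by
  have hn : 2 ≤ n := by have : (2 : ℝ) ≤ n := by linarith
                        exact_mod_cast this
  have hs := (integrable_singularPart hn (by linarith) 1 (l := l)).comp_sub_left x
  refine ((hs.mul_const A).add hfi.norm).mono' ?_ (.of_forall fun y => ?_)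
  · exact (by fun_prop : Measurable fun y : E n => ‖x - y‖ ^ (-(2 * l))).aestronglyMeasurable.mul
      hf.aestronglyMeasurable
  · rw [norm_mul, Real.norm_of_nonneg (by positivity)]
    simp only [Pi.add_apply]
    by_cases hz : x - y ∈ Metric.ball (0 : E n) 1
    · rw [singularPart, Set.indicator_of_mem hz]
      have := mul_le_mul_of_nonneg_left (hA y) (by positivity : 0 ≤ ‖x - y‖ ^ (-(2 * l)))
      rw [Real.norm_eq_abs]
      linarith [abs_nonneg (f y)]
    · rw [singularPart, Set.indicator_of_notMem hz, zero_mul, zero_add]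
      rw [mem_ball_zero_iff, not_lt] at hz
      exact mul_le_of_le_one_left (norm_nonneg _)
          (Real.rpow_le_one_of_one_le_of_nonpos hz (by linarith))

/-- Multipole expansion of the Newtonian potential of a density with decay `‖y‖ ^ (-a)`. -/
theorem potential_expansion (hl : 2 * l + 2 = n) (hl1 : 1 ≤ l) {f : E n → ℝ}
    (hf : Continuous f) {A a : ℝ} (hA : ∀ y, |f y| ≤ A * (1 + ‖y‖) ^ (-a)) (N : ℕ) {β : ℝ}
    (hβ : N ≤ β) (hβ' : β ≤ N + 1) (ha : β + n < a) :
    ∃ C, ∀ x : E n, 1 ≤ ‖x‖ →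
      |(∫ y, ‖x - y‖ ^ (-(2 * l)) * f y) - ∑ k ∈ Finset.range (N + 1),
        ‖x‖ ^ (-(2 * l) - 2 * k) * MvPolynomial.eval (fun i => x i) (zonalMoment l f k)|
      ≤ C * ‖x‖ ^ (-(2 * l) - β) := by
  obtain ⟨C, hC, hker⟩ := kernel_expansion hl1 N hβ hβ'
  have hn : 2 ≤ n := by have : (2 : ℝ) ≤ n := by linarith
                        exact_mod_cast this
  have hβ0 : 0 ≤ β := le_trans (by positivity) hβ
  have hA0 : 0 ≤ A := by simpa using (abs_nonneg _).trans (hA 0)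
  have hAb : ∀ y, |f y| ≤ A := fun y => (hA y).trans (mul_le_of_le_one_right hA0
    (Real.rpow_le_one_of_one_le_of_nonpos (by linarith [norm_nonneg y])
      (by have : (0:ℝ) ≤ n := by positivity
          linarith)))
  have hfi : Integrable f := by
    have := integrable_rpow_mul_of_decay hf hA le_rfl (by linarith)
    simpa using this
  have hmom : ∀ k ∈ Finset.range (N + 1), Integrable (fun y => ‖y‖ ^ k * f y) := fun k hk => by
    have hk : (k : ℝ) ≤ N := by exact_mod_cast Nat.lt_succ_iff.1 (Finset.mem_range.1 hk)
    have := integrable_rpow_mul_of_decay hf hA (b := k) (by positivity) (by linarith)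
    simpa using this
  have hβi : Integrable (fun y => ‖y‖ ^ β * |f y|) :=
    integrable_rpow_mul_of_decay hf.abs (A := A) (a := a) (by simpa using hA) hβ0 ha
  set J := ∫ y, ‖y‖ ^ β * |f y| with hJ
  set I := ∫ z : E n, singularPart l 1 z with hI
  have hInn : 0 ≤ I := integral_nonneg fun z => singularPart_nonneg l 1 z
  refine ⟨C * J + A * 2 ^ (a - 2) * I, fun x hx => ?_⟩
  have hx0 : x ≠ 0 := by rintro rfl; simp at hx; linarith
  have hxp : 0 < ‖x‖ := by linarith
  have hzi : ∀ k ∈ Finset.range (N + 1), Integrable (fun y => ‖x‖ ^ (-(2 * l) - 2 * k) *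
      (gegenbauer l (inner ℝ x y) (‖x‖ ^ 2 * ‖y‖ ^ 2) k * f y)) := fun k hk => by
    refine Integrable.const_mul ?_ _
    have := integrable_finsetSum (Finset.finsuppAntidiag Finset.univ k) fun m _ =>
      (integrable_coeff_zonal l hf (hmom k hk) m).mul_const
        (MvPolynomial.eval (fun i => x i) (MvPolynomial.monomial m 1))
    refine this.congr (.of_forall fun y => ?_)
    simp only
    rw [← eval_zonal, ← sum_coeff_zonal, map_sum, Finset.sum_mul]
    refine Finset.sum_congr rfl fun m _ => ?_
    simp only [MvPolynomial.eval_monomial, sum_coeff_zonal]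
    ring
  have hlhs : (∫ y, ‖x - y‖ ^ (-(2 * l)) * f y) - ∑ k ∈ Finset.range (N + 1),
        ‖x‖ ^ (-(2 * l) - 2 * k) * MvPolynomial.eval (fun i => x i) (zonalMoment l f k)
      = ∫ y, (‖x - y‖ ^ (-(2 * l)) - ∑ k ∈ Finset.range (N + 1), ‖x‖ ^ (-(2 * l) - 2 * k) *
        gegenbauer l (inner ℝ x y) (‖x‖ ^ 2 * ‖y‖ ^ 2) k) * f y := by
    have h1 : ∀ k ∈ Finset.range (N + 1), ‖x‖ ^ (-(2 * l) - 2 * k) *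
        MvPolynomial.eval (fun i => x i) (zonalMoment l f k) =
        ∫ y, ‖x‖ ^ (-(2 * l) - 2 * k) *
          (gegenbauer l (inner ℝ x y) (‖x‖ ^ 2 * ‖y‖ ^ 2) k * f y) := fun k hk => by
      rw [eval_zonalMoment l hf (hmom k hk), integral_const_mul]
    rw [Finset.sum_congr rfl h1, ← integral_finsetSum _ hzi, ← integral_sub
      (integrable_kernel_mul hl (by linarith) hf hfi hAb x) (integrable_finsetSum _ hzi)]
    refine integral_congr_ae (.of_forall fun y => ?_)
    simp only [sub_mul, Finset.sum_mul, mul_assoc]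
  rw [hlhs, ← Real.norm_eq_abs]
  have hs := (integrable_singularPart hn (by linarith) (‖x‖ / 2) (l := l) (n := n)).comp_sub_left x
  have hdom : Integrable (fun y => C * ‖x‖ ^ (-(2 * l) - β) * (‖y‖ ^ β * |f y|)
      + A * (‖x‖ / 2) ^ (-a) * singularPart l (‖x‖ / 2) (x - y)) :=
    (hβi.const_mul _).add (hs.const_mul _)
  refine (norm_integral_le_of_norm_le hdom (.of_forall fun y => ?_)).trans ?_
  · rw [norm_mul, Real.norm_eq_abs, Real.norm_eq_abs]
    refine (mul_le_mul_of_nonneg_right (hker n x y hx0) (abs_nonneg _)).trans ?_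
    rw [add_mul]
    have h2 : singularPart l (‖x‖ / 2) (x - y) * |f y|
        ≤ A * (‖x‖ / 2) ^ (-a) * singularPart l (‖x‖ / 2) (x - y) := by
      by_cases hz : x - y ∈ Metric.ball (0 : E n) (‖x‖ / 2)
      · rw [mul_comm]
        refine mul_le_mul_of_nonneg_right ((hA y).trans ?_) (singularPart_nonneg _ _ _)
        rw [mem_ball_zero_iff] at hz
        have : ‖x‖ ≤ ‖x - y‖ + ‖y‖ := by simpa using norm_add_le (x - y) y
        gcongr ?_ * ?_
        refine Real.rpow_le_rpow_of_nonpos (by positivity) (by linarith) ?_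
        have : (0:ℝ) ≤ n := by positivity
        linarith
      · rw [singularPart, Set.indicator_of_notMem hz]; simp
    linarith
  · rw [integral_add (hβi.const_mul _) (hs.const_mul _), integral_const_mul, integral_const_mul,
      integral_sub_left_eq_self (fun z => singularPart l (‖x‖ / 2) z) volume x,
      integral_singularPart hl (by positivity), ← hJ, ← hI]
    have h3 : (‖x‖ / 2) ^ (-a) * (‖x‖ / 2) ^ 2 = 2 ^ (a - 2) * ‖x‖ ^ (2 - a) := by
      rw [← Real.rpow_natCast, ← Real.rpow_add (by positivity), Real.div_rpow hxp.le (by norm_num),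
        div_eq_mul_inv, ← Real.rpow_neg (by norm_num), mul_comm]
      push_cast
      congr 2 <;> ring
    have h4 : ‖x‖ ^ (2 - a) ≤ ‖x‖ ^ (-(2 * l) - β) :=
      Real.rpow_le_rpow_of_exponent_le hx (by linarith)
    calc _ = C * J * ‖x‖ ^ (-(2 * l) - β) + A * ((‖x‖ / 2) ^ (-a) * (‖x‖ / 2) ^ 2) * I := by ring
      _ = C * J * ‖x‖ ^ (-(2 * l) - β) + A * 2 ^ (a - 2) * I * ‖x‖ ^ (2 - a) := by rw [h3]; ring
      _ ≤ C * J * ‖x‖ ^ (-(2 * l) - β) + A * 2 ^ (a - 2) * I * ‖x‖ ^ (-(2 * l) - β) := by gcongr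
      _ = _ := by ring

end Convolution

section Representation

open MeasureTheory

variable {n : ℕ} {l : ℝ}

/-- `f` and its first and unmixed second partial derivatives are `O((1 + ‖z‖) ^ (-a))`. -/
def HasDecay (a : ℝ) (f : E n → ℝ) : Prop :=
  ∃ C : ℝ, ∀ z : E n, |f z| ≤ C * (1 + ‖z‖) ^ (-a) ∧ ∀ i : Fin n,
    |fderiv ℝ f z (EuclideanSpace.single i 1)| ≤ C * (1 + ‖z‖) ^ (-a) ∧
    |fderiv ℝ (fun y => fderiv ℝ f y (EuclideanSpace.single i 1)) z (EuclideanSpace.single i 1)|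
      ≤ C * (1 + ‖z‖) ^ (-a)

theorem integrable_mul_of_decay {f g : E n → ℝ} (hf : Continuous f) (hg : Continuous g)
    {A B a b : ℝ} (hA : ∀ y, |f y| ≤ A * (1 + ‖y‖) ^ (-a)) (hB : ∀ y, |g y| ≤ B * (1 + ‖y‖) ^ (-b))
    (hab : n < a + b) : Integrable (fun y => f y * g y) := by
  have hi : Integrable (fun y : E n => (1 + ‖y‖) ^ (-(a + b))) :=
    integrable_one_add_norm (by simpa using hab)
  refine (hi.const_mul (A * B)).mono' (hf.mul hg).aestronglyMeasurable (.of_forall fun y => ?_)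
  have h1 : (0 : ℝ) < 1 + ‖y‖ := by positivity
  rw [norm_mul, Real.norm_eq_abs, Real.norm_eq_abs, neg_add, Real.rpow_add h1]
  calc _ ≤ (A * (1 + ‖y‖) ^ (-a)) * (B * (1 + ‖y‖) ^ (-b)) :=
        mul_le_mul (hA y) (hB y) (abs_nonneg _) ((abs_nonneg _).trans (hA y))
    _ = _ := by ring

theorem contDiff_partial {f : E n → ℝ} {m : ℕ} (hf : ContDiff ℝ (m + 1) f) (v : E n) :
    ContDiff ℝ m (fun y => fderiv ℝ f y v) :=
  (hf.fderiv_right le_rfl).clm_apply contDiff_const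

theorem continuous_lap {f : E n → ℝ} (hf : ContDiff ℝ 2 f) : Continuous (lap n f) := by
  unfold lap
  refine continuous_finsetSum _ fun i _ => ?_
  have h1 : ContDiff ℝ 1 (fun y => fderiv ℝ f y (EuclideanSpace.single i 1)) :=
    contDiff_partial (m := 1) hf _
  exact (contDiff_partial (m := 0) h1 _).continuous

/-- Green's second identity on `ℝⁿ` for functions with joint decay. -/
theorem integral_mul_lap {f g : E n → ℝ} (hf : ContDiff ℝ 2 f) (hg : ContDiff ℝ 2 g) {a b : ℝ}
    (hfa : HasDecay a f) (hgb : HasDecay b g) (hab : n < a + b) :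
    ∫ z, f z * lap n g z = ∫ z, lap n f z * g z := by
  obtain ⟨A, hA⟩ := hfa
  obtain ⟨B, hB⟩ := hgb
  have hf1 : ∀ i, ContDiff ℝ 1 (fun y => fderiv ℝ f y (EuclideanSpace.single i 1)) := fun i =>
    contDiff_partial (m := 1) hf _
  have hg1 : ∀ i, ContDiff ℝ 1 (fun y => fderiv ℝ g y (EuclideanSpace.single i 1)) := fun i =>
    contDiff_partial (m := 1) hg _
  have hf2 := fun i => (contDiff_partial (m := 0) (hf1 i) (EuclideanSpace.single i 1)).continuous
  have hg2 := fun i => (contDiff_partial (m := 0) (hg1 i) (EuclideanSpace.single i 1)).continuous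
  have i02 := fun i => integrable_mul_of_decay hf.continuous (hg2 i) (fun y => (hA y).1)
    (fun y => ((hB y).2 i).2) hab
  have i20 := fun i => integrable_mul_of_decay (hf2 i) hg.continuous (fun y => ((hA y).2 i).2)
    (fun y => (hB y).1) hab
  have i11 := fun i => integrable_mul_of_decay (hf1 i).continuous (hg1 i).continuous
    (fun y => ((hA y).2 i).1) (fun y => ((hB y).2 i).1) hab
  have i01 := fun i => integrable_mul_of_decay hf.continuous (hg1 i).continuous
    (fun y => (hA y).1) (fun y => ((hB y).2 i).1) hab
  have i10 := fun i => integrable_mul_of_decay (hf1 i).continuous hg.continuous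
    (fun y => ((hA y).2 i).1) (fun y => (hB y).1) hab
  simp only [lap, Finset.mul_sum, Finset.sum_mul]
  rw [integral_finsetSum _ fun i _ => i02 i, integral_finsetSum _ fun i _ => i20 i]
  refine Finset.sum_congr rfl fun i _ => ?_
  rw [integral_mul_fderiv_eq_neg_fderiv_mul_of_integrable (i11 i) (i02 i) (i01 i)
      (fun x _ => hf.differentiable (by simp) x) (fun x _ => (hg1 i).differentiable (by simp) x),
    integral_mul_fderiv_eq_neg_fderiv_mul_of_integrable (i20 i) (i11 i) (i10 i)
      (fun x _ => (hf1 i).differentiable (by simp) x) (fun x _ => hg.differentiable (by simp) x),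
    neg_neg]

/-- The regularized kernel `(‖z‖² + δ²) ^ (-l)`. -/
def regKernel (l δ : ℝ) (z : E n) : ℝ := (‖z‖ ^ 2 + δ ^ 2) ^ (-l)

theorem hasFDerivAt_norm_sq_add_rpow {δ : ℝ} (hδ : 0 < δ) (s : ℝ) (z : E n) :
    HasFDerivAt (fun z : E n => (‖z‖ ^ 2 + δ ^ 2) ^ s)
      ((2 * s * (‖z‖ ^ 2 + δ ^ 2) ^ (s - 1)) • innerSL ℝ z) z := by
  have h1 : HasFDerivAt (fun z : E n => ‖z‖ ^ 2 + δ ^ 2) (2 • innerSL ℝ z) z :=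
    (hasStrictFDerivAt_norm_sq z).hasFDerivAt.add_const _
  have h2 := h1.rpow_const (p := s) (Or.inl (by positivity))
  refine h2.congr_fderiv ?_
  ext v
  simp
  ring

theorem contDiff_regKernel {δ : ℝ} (hδ : 0 < δ) {m : WithTop ℕ∞} :
    ContDiff ℝ m (regKernel l δ : E n → ℝ) :=
  ((contDiff_norm_sq ℝ).add contDiff_const).rpow_const_of_ne fun z => by positivity

theorem partial_regKernel {δ : ℝ} (hδ : 0 < δ) (z : E n) (i : Fin n) :
    fderiv ℝ (regKernel l δ) z (EuclideanSpace.single i 1)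
      = -2 * l * (‖z‖ ^ 2 + δ ^ 2) ^ (-l - 1) * z i := by
  have h := (hasFDerivAt_norm_sq_add_rpow hδ (-l) z).fderiv
  unfold regKernel
  rw [h]
  simp [EuclideanSpace.inner_single_right]

theorem partial_partial_regKernel {δ : ℝ} (hδ : 0 < δ) (z : E n) (i : Fin n) :
    fderiv ℝ (fun y => fderiv ℝ (regKernel l δ) y (EuclideanSpace.single i 1)) z
      (EuclideanSpace.single i 1)
      = -2 * l * (‖z‖ ^ 2 + δ ^ 2) ^ (-l - 1)
        + 4 * l * (l + 1) * (‖z‖ ^ 2 + δ ^ 2) ^ (-l - 2) * z i ^ 2 := by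
  simp only [partial_regKernel hδ]
  have h1 := (hasFDerivAt_norm_sq_add_rpow hδ (-l - 1) z).const_mul (-2 * l)
  have h2 : HasFDerivAt (fun y : E n => y i) (EuclideanSpace.proj i : E n →L[ℝ] ℝ) z :=
    (EuclideanSpace.proj i : E n →L[ℝ] ℝ).hasFDerivAt
  rw [(h1.fun_mul h2).fderiv]
  simp [EuclideanSpace.inner_single_right]
  rw [show -l - 1 - 1 = -l - 2 by ring]
  ring

theorem lap_regKernel (hl : 2 * l + 2 = n) {δ : ℝ} (hδ : 0 < δ) (z : E n) :
    lap n (regKernel l δ) z = -(4 * l * (l + 1)) * δ ^ 2 * (‖z‖ ^ 2 + δ ^ 2) ^ (-l - 2) := by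
  have hQ : 0 < ‖z‖ ^ 2 + δ ^ 2 := by positivity
  simp only [lap, partial_partial_regKernel hδ]
  rw [Finset.sum_add_distrib, ← Finset.mul_sum, ← Finset.mul_sum]
  have hs : ∑ i, z i ^ 2 = ‖z‖ ^ 2 := by rw [EuclideanSpace.norm_sq_eq]; simp
  rw [hs]
  have : (‖z‖ ^ 2 + δ ^ 2) ^ (-l - 1) = (‖z‖ ^ 2 + δ ^ 2) ^ (-l - 2) * (‖z‖ ^ 2 + δ ^ 2) := by
    rw [← Real.rpow_add_one hQ.ne']; ring_nf
  simp [this, ← hl]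
  ring

theorem hasDecay_regKernel (hl : 0 ≤ l) {δ : ℝ} (hδ : 0 < δ) (hδ1 : δ ≤ 1) :
    HasDecay (2 * l) (regKernel l δ : E n → ℝ) := by
  have key : ∀ z : E n, (‖z‖ ^ 2 + δ ^ 2) ^ (-l) ≤ (δ ^ 2 / 2) ^ (-l) * (1 + ‖z‖) ^ (-(2 * l)) := by
    intro z
    have h1 : (1 + ‖z‖) ^ (-(2 * l)) = ((1 + ‖z‖) ^ 2) ^ (-l) := by
      rw [← Real.rpow_natCast, ← Real.rpow_mul (by positivity)]; congr 1; push_cast; ring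
    rw [h1, ← Real.mul_rpow (by positivity) (by positivity)]
    refine Real.rpow_le_rpow_of_nonpos (by positivity) ?_ (by linarith)
    have : δ ^ 2 ≤ 1 := by nlinarith
    nlinarith [sq_nonneg (1 - ‖z‖), sq_nonneg ‖z‖, sq_nonneg δ]
  set D := (δ ^ 2 / 2) ^ (-l)
  set K := 1 + 2 * l / δ ^ 2 + 4 * l * (l + 1) / δ ^ 2 with hK
  have hKnn : 0 ≤ K := by positivity
  refine ⟨K * D, fun z => ?_⟩
  have hQ : 0 < ‖z‖ ^ 2 + δ ^ 2 := by positivity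
  have main : ∀ t c : ℝ, |t| ≤ c * (‖z‖ ^ 2 + δ ^ 2) ^ (-l) → c ≤ K →
      |t| ≤ K * D * (1 + ‖z‖) ^ (-(2 * l)) := by
    intro t c h1 h2
    calc |t| ≤ c * (‖z‖ ^ 2 + δ ^ 2) ^ (-l) := h1
      _ ≤ K * (D * (1 + ‖z‖) ^ (-(2 * l))) := by
          refine mul_le_mul h2 (key z) (by positivity) hKnn
      _ = _ := by ring
  have hdl : 0 ≤ 2 * l / δ ^ 2 := by positivity
  have hdl' : 0 ≤ 4 * l * (l + 1) / δ ^ 2 := by positivity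
  have e1 : (‖z‖ ^ 2 + δ ^ 2) ^ (-l - 1) = (‖z‖ ^ 2 + δ ^ 2) ^ (-l) / (‖z‖ ^ 2 + δ ^ 2) := by
    rw [Real.rpow_sub_one hQ.ne']
  have e2 : (‖z‖ ^ 2 + δ ^ 2) ^ (-l - 2) = (‖z‖ ^ 2 + δ ^ 2) ^ (-l) / (‖z‖ ^ 2 + δ ^ 2) ^ 2 := by
    rw [show -l - 2 = -l - ((2 : ℕ) : ℝ) by simp, Real.rpow_sub_natCast hQ.ne']
  have hinv : 1 / (‖z‖ ^ 2 + δ ^ 2) ≤ 1 / δ ^ 2 := by gcongr; nlinarith [sq_nonneg ‖z‖]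
  refine ⟨main _ 1 ?_ (by linarith), fun i => ?_⟩
  · rw [regKernel, abs_of_nonneg (by positivity), one_mul]
  have hzi : |z i| ≤ ‖z‖ := by simpa using PiLp.norm_apply_le z i
  have hzi2 : z i ^ 2 ≤ ‖z‖ ^ 2 := by rw [← sq_abs]; gcongr
  constructor
  · refine main _ (2 * l / δ ^ 2) ?_ (by linarith)
    rw [partial_regKernel hδ, e1]
    have h3 : |z i| / (‖z‖ ^ 2 + δ ^ 2) ≤ 1 / δ ^ 2 := by
      rw [div_le_div_iff₀ hQ (by positivity)]
      have h4 : ‖z‖ * δ ≤ ‖z‖ ^ 2 + δ ^ 2 := by nlinarith [sq_nonneg (‖z‖ - δ)]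
      nlinarith [norm_nonneg z, mul_nonneg (norm_nonneg z) hδ.le]
    calc _ = 2 * l * (‖z‖ ^ 2 + δ ^ 2) ^ (-l) * (|z i| / (‖z‖ ^ 2 + δ ^ 2)) := by
          rw [show -2 * l * ((‖z‖ ^ 2 + δ ^ 2) ^ (-l) / (‖z‖ ^ 2 + δ ^ 2)) * z i
            = -(2 * l * (‖z‖ ^ 2 + δ ^ 2) ^ (-l) / (‖z‖ ^ 2 + δ ^ 2)) * z i by ring, abs_mul,
                abs_neg,
            abs_of_nonneg (by positivity)]
          ring
      _ ≤ 2 * l * (‖z‖ ^ 2 + δ ^ 2) ^ (-l) * (1 / δ ^ 2) := by gcongr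
      _ = _ := by ring
  · refine main _ (2 * l / δ ^ 2 + 4 * l * (l + 1) / δ ^ 2) ?_ (by linarith)
    rw [partial_partial_regKernel hδ, e1, e2]
    have h3 : z i ^ 2 / (‖z‖ ^ 2 + δ ^ 2) ^ 2 ≤ 1 / δ ^ 2 := by
      refine le_trans ?_ hinv
      rw [div_le_div_iff₀ (by positivity) hQ]
      nlinarith [sq_nonneg δ]
    refine (abs_add_le _ _).trans ?_
    rw [add_mul]
    have ea : |-2 * l * ((‖z‖ ^ 2 + δ ^ 2) ^ (-l) / (‖z‖ ^ 2 + δ ^ 2))|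
        = 2 * l * (‖z‖ ^ 2 + δ ^ 2) ^ (-l) * (1 / (‖z‖ ^ 2 + δ ^ 2)) := by
      rw [show -2 * l * ((‖z‖ ^ 2 + δ ^ 2) ^ (-l) / (‖z‖ ^ 2 + δ ^ 2))
        = -(2 * l * (‖z‖ ^ 2 + δ ^ 2) ^ (-l) * (1 / (‖z‖ ^ 2 + δ ^ 2))) by ring, abs_neg,
        abs_of_nonneg (by positivity)]
    have eb : |4 * l * (l + 1) * ((‖z‖ ^ 2 + δ ^ 2) ^ (-l) / (‖z‖ ^ 2 + δ ^ 2) ^ 2) * z i ^ 2|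
        = 4 * l * (l + 1) * (‖z‖ ^ 2 + δ ^ 2) ^ (-l) * (z i ^ 2 / (‖z‖ ^ 2 + δ ^ 2) ^ 2) := by
      rw [abs_of_nonneg (by positivity)]; ring
    rw [ea, eb]
    refine add_le_add ?_ ?_
    · calc _ ≤ 2 * l * (‖z‖ ^ 2 + δ ^ 2) ^ (-l) * (1 / δ ^ 2) := by gcongr
        _ = _ := by ring
    · calc _ ≤ 4 * l * (l + 1) * (‖z‖ ^ 2 + δ ^ 2) ^ (-l) * (1 / δ ^ 2) := by gcongr
        _ = _ := by ring

/-- The normalizing constant of the Newtonian potential. -/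
def newtonConst (n : ℕ) (l : ℝ) : ℝ :=
  4 * l * (l + 1) * ∫ z : E n, (‖z‖ ^ 2 + 1) ^ (-l - 2)

theorem integrable_norm_sq_add_one_rpow (hl : 2 * l + 2 = n) :
    Integrable (fun z : E n => (‖z‖ ^ 2 + 1) ^ (-l - 2)) := by
  have := integrable_rpow_neg_one_add_norm_sq (E := E n) (μ := volume) (r := 2 * l + 4)
    (by simp; linarith)
  refine this.congr (.of_forall fun z => ?_)
  simp only
  rw [add_comm]
  congr 1
  ring

theorem newtonConst_pos (hl : 2 * l + 2 = n) (hl0 : 0 < l) : 0 < newtonConst n l := by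
  refine mul_pos (by positivity) ?_
  rw [integral_pos_iff_support_of_nonneg (fun z => by positivity)
    (integrable_norm_sq_add_one_rpow hl)]
  have : Function.support (fun z : E n => (‖z‖ ^ 2 + 1) ^ (-l - 2)) = Set.univ := by
    ext z
    simp only [Function.mem_support, Set.mem_univ, iff_true]
    positivity
  rw [this]
  exact Measure.measure_univ_pos.2 (NeZero.ne _)

theorem integral_lap_regKernel_mul (hl : 2 * l + 2 = n) {δ : ℝ} (hδ : 0 < δ) (w : E n → ℝ) :
    ∫ z, lap n (regKernel l δ) z * w z
      = -(4 * l * (l + 1)) * ∫ z : E n, (‖z‖ ^ 2 + 1) ^ (-l - 2) * w (δ • z) := by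
  simp only [lap_regKernel hl hδ, mul_assoc _ _ (w _), integral_const_mul]
  have h := Measure.integral_comp_smul (volume : Measure (E n))
    (fun z => (‖z‖ ^ 2 + δ ^ 2) ^ (-l - 2) * w z) δ
  have hδn : 0 < δ ^ n := by positivity
  simp only [finrank_euclideanSpace, Fintype.card_fin, abs_of_pos (inv_pos.2 hδn), smul_eq_mul] at h
  rw [inv_mul_eq_div, eq_div_iff hδn.ne'] at h
  rw [← h, mul_assoc]
  congr 1
  rw [← integral_mul_const, ← integral_const_mul]
  congr 1 with z
  have e1 : ‖δ • z‖ ^ 2 + δ ^ 2 = δ ^ 2 * (‖z‖ ^ 2 + 1) := by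
    rw [norm_smul, Real.norm_of_nonneg hδ.le]; ring
  have e2 : δ ^ n * δ ^ 2 * (δ ^ 2) ^ (-l - 2) = 1 := by
    rw [← Real.rpow_natCast δ n, ← hl, ← Real.rpow_natCast, ← Real.rpow_mul hδ.le,
      ← Real.rpow_add hδ, ← Real.rpow_add hδ]
    convert Real.rpow_zero δ using 2
    push_cast
    ring
  rw [e1, Real.mul_rpow (by positivity) (by positivity)]
  linear_combination ((‖z‖ ^ 2 + 1) ^ (-l - 2) * w (δ • z)) * e2

open Filter Topology in
theorem representation_zero (hl : 2 * l + 2 = n) (hl1 : 1 ≤ l) {w : E n → ℝ}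
    (hw : ContDiff ℝ 2 w) {a : ℝ} (ha : 2 < a) (hdec : HasDecay a w)
    (hint : Integrable (fun z => ‖z‖ ^ (-(2 * l)) * lap n w z)) :
    ∫ z, ‖z‖ ^ (-(2 * l)) * lap n w z = -newtonConst n l * w 0 := by
  have hn : Nonempty (Fin n) := by
    refine Fin.pos_iff_nonempty.1 ?_
    have : (0 : ℝ) < n := by linarith
    exact_mod_cast this
  set d : ℕ → ℝ := fun m => 1 / ((m : ℝ) + 1)
  have hd : ∀ m, 0 < d m := fun m => by positivity
  have hd1 : ∀ m, d m ≤ 1 := fun m => by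
    simp only [d]; rw [div_le_one (by positivity)]; linarith [(Nat.cast_nonneg m : (0 : ℝ) ≤ m)]
  have hdlim : Tendsto d atTop (𝓝 0) := tendsto_one_div_add_atTop_nhds_zero_nat
  have hid : ∀ m, ∫ z, regKernel l (d m) z * lap n w z
      = -(4 * l * (l + 1)) * ∫ z : E n, (‖z‖ ^ 2 + 1) ^ (-l - 2) * w (d m • z) := fun m => by
    rw [integral_mul_lap (contDiff_regKernel (hd m)) hw
      (hasDecay_regKernel (by linarith) (hd m) (hd1 m)) hdec (by linarith),
      integral_lap_regKernel_mul hl (hd m)]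
  obtain ⟨C, hC⟩ := hdec
  have hC0 : 0 ≤ C := by simpa using (abs_nonneg _).trans (hC 0).1
  have hwb : ∀ z, |w z| ≤ C := fun z => (hC z).1.trans (mul_le_of_le_one_right hC0
    (Real.rpow_le_one_of_one_le_of_nonpos (by linarith [norm_nonneg z]) (by linarith)))
  have lim1 : Tendsto (fun m => ∫ z : E n, (‖z‖ ^ 2 + 1) ^ (-l - 2) * w (d m • z)) atTop
      (𝓝 (∫ z : E n, (‖z‖ ^ 2 + 1) ^ (-l - 2) * w 0)) := by
    refine tendsto_integral_of_dominated_convergence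
      (fun z => (‖z‖ ^ 2 + 1) ^ (-l - 2) * C) (fun m => ?_)
      ((integrable_norm_sq_add_one_rpow hl).mul_const C) (fun m => .of_forall fun z => ?_)
      (.of_forall fun z => ?_)
    · exact (integrable_norm_sq_add_one_rpow hl).aestronglyMeasurable.mul
        (hw.continuous.comp (continuous_const_smul _)).aestronglyMeasurable
    · rw [norm_mul, Real.norm_of_nonneg (by positivity), Real.norm_eq_abs]
      gcongr
      exact hwb _
    · refine Tendsto.const_mul _ ?_
      have : Tendsto (fun m => d m • z) atTop (𝓝 ((0 : ℝ) • z)) := hdlim.smul_const z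
      rw [zero_smul] at this
      exact (hw.continuous.tendsto 0).comp this
  have lim2 : Tendsto (fun m => ∫ z, regKernel l (d m) z * lap n w z) atTop
      (𝓝 (∫ z, ‖z‖ ^ (-(2 * l)) * lap n w z)) := by
    have hne : ∀ᵐ z : E n, z ≠ 0 := by simp [ae_iff]
    have hlc := continuous_lap hw
    refine tendsto_integral_of_dominated_convergence
      (fun z => ‖‖z‖ ^ (-(2 * l)) * lap n w z‖) (fun m => ?_) hint.norm (fun m => ?_) ?_
    · exact ((contDiff_regKernel (m := 0) (hd m)).continuous.mul hlc).aestronglyMeasurable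
    · filter_upwards [hne] with z hz
      have hz' : 0 < ‖z‖ := norm_pos_iff.2 hz
      have hk : regKernel l (d m) z ≤ ‖z‖ ^ (-(2 * l)) := by
        rw [regKernel, show -(2 * l) = 2 * -l by ring, Real.rpow_mul hz'.le]
        refine Real.rpow_le_rpow_of_nonpos (by positivity) ?_ (by linarith)
        simp
        positivity
      have hk0 : 0 ≤ regKernel l (d m) z := Real.rpow_nonneg (by positivity) _
      rw [norm_mul, norm_mul, Real.norm_of_nonneg hk0,
        Real.norm_of_nonneg (by positivity : 0 ≤ ‖z‖ ^ (-(2 * l)))]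
      exact mul_le_mul_of_nonneg_right hk (norm_nonneg _)
    · filter_upwards [hne] with z hz
      have hz' : 0 < ‖z‖ := norm_pos_iff.2 hz
      refine Tendsto.mul_const _ ?_
      have h1 : Tendsto (fun m => ‖z‖ ^ 2 + d m ^ 2) atTop (𝓝 (‖z‖ ^ 2 + 0 ^ 2)) :=
        (hdlim.pow 2).const_add _
      have h2 := h1.rpow_const (p := -l) (Or.inl (by positivity))
      simp only [regKernel]
      refine h2.trans (le_of_eq ?_)
      congr 1
      rw [show -(2 * l) = 2 * -l by ring, Real.rpow_mul hz'.le]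
      simp
  have := tendsto_nhds_unique lim2 ((lim1.const_mul (-(4 * l * (l + 1)))).congr fun m =>
      (hid m).symm)
  rw [this, integral_mul_const, newtonConst]
  ring

theorem lap_comp_add_left (f : E n → ℝ) (x z : E n) :
    lap n (fun y => f (x + y)) z = lap n f (x + z) := by
  simp only [lap, fderiv_comp_add_left]
  refine Finset.sum_congr rfl fun i _ => ?_
  rw [fderiv_comp_add_left (f := fun y => fderiv ℝ f y (EuclideanSpace.single i 1))]

theorem HasDecay.comp_add_left {a : ℝ} (ha : 0 ≤ a) {f : E n → ℝ} (hf : HasDecay a f) (x : E n) :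
    HasDecay a (fun y => f (x + y)) := by
  obtain ⟨C, hC⟩ := hf
  have hC0 : 0 ≤ C := by simpa using (abs_nonneg _).trans (hC 0).1
  have key : ∀ z : E n, C * (1 + ‖x + z‖) ^ (-a) ≤ C * (1 + ‖x‖) ^ a * (1 + ‖z‖) ^ (-a) := by
    intro z
    rw [mul_assoc]
    gcongr
    have h1 : 1 + ‖z‖ ≤ (1 + ‖x‖) * (1 + ‖x + z‖) := by
      have : ‖z‖ ≤ ‖x + z‖ + ‖x‖ := by simpa using norm_sub_le (x + z) x
      nlinarith [norm_nonneg x, norm_nonneg (x + z)]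
    have h2 := Real.rpow_le_rpow (by positivity) h1 ha
    rw [Real.mul_rpow (by positivity) (by positivity)] at h2
    rw [Real.rpow_neg (by positivity), Real.rpow_neg (by positivity), ← div_eq_mul_inv,
      inv_eq_one_div, div_le_div_iff₀ (by positivity) (by positivity)]
    linarith
  refine ⟨C * (1 + ‖x‖) ^ a, fun z => ⟨(hC _).1.trans (key z), fun i => ⟨?_, ?_⟩⟩⟩
  · rw [fderiv_comp_add_left]
    exact ((hC _).2 i).1.trans (key z)
  · simp only [fderiv_comp_add_left]
    rw [fderiv_comp_add_left (f := fun y => fderiv ℝ f y (EuclideanSpace.single i 1))]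
    exact ((hC _).2 i).2.trans (key z)

/-- A decaying function is the Newtonian potential of its Laplacian. -/
theorem representation (hl : 2 * l + 2 = n) (hl1 : 1 ≤ l) {w : E n → ℝ}
    (hw : ContDiff ℝ 2 w) {a : ℝ} (ha : 2 < a) (hdec : HasDecay a w) (x : E n)
    (hint : Integrable (fun y => ‖x - y‖ ^ (-(2 * l)) * lap n w y)) :
    ∫ y, ‖x - y‖ ^ (-(2 * l)) * lap n w y = -newtonConst n l * w x := by
  have h1 : ∀ z : E n, ‖z‖ ^ (-(2 * l)) * lap n (fun y => w (x + y)) z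
      = ‖x - (x + z)‖ ^ (-(2 * l)) * lap n w (x + z) := fun z => by
    rw [lap_comp_add_left]; simp
  have h2 := representation_zero hl hl1 (w := fun y => w (x + y))
    (hw.comp (contDiff_const.add contDiff_id)) ha (hdec.comp_add_left (by linarith) x)
    ((hint.comp_add_left x).congr (.of_forall fun z => (h1 z).symm))
  simp only [h1, add_zero] at h2
  rw [← h2]
  exact (integral_add_left_eq_self (fun y => ‖x - y‖ ^ (-(2 * l)) * lap n w y) x).symm

end Representation

section Interpolation

open scoped ContDiff

variable {n : ℕ}

/-- Landau's inequality on the exterior of a ball. -/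
theorem norm_fderiv_le_of_exterior {F : Type*} [NormedAddCommGroup F] [NormedSpace ℝ F]
    {w : E n → F} (hw : ContDiff ℝ 2 w) {r h M₀ M₂ : ℝ} (hh : 0 < h)
    (h0 : ∀ x, r ≤ ‖x‖ → ‖w x‖ ≤ M₀) (h2 : ∀ x, r ≤ ‖x‖ → ‖fderiv ℝ (fderiv ℝ w) x‖ ≤ M₂)
    {x : E n} (hx : r ≤ ‖x‖) : ‖fderiv ℝ w x‖ ≤ 2 * M₀ / h + h * M₂ := by
  have hM0 : 0 ≤ M₀ := (norm_nonneg _).trans (h0 x hx)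
  have hM2 : 0 ≤ M₂ := (norm_nonneg (fderiv ℝ (fderiv ℝ w) x)).trans (h2 x hx)
  set H : Set (E n) := {y | inner ℝ x x ≤ inner ℝ x y} with hH
  have hHc : Convex ℝ H := convex_halfSpace_ge (innerSL ℝ x).toLinearMap.isLinear _
  have hxH : x ∈ H := le_refl (inner ℝ x x)
  have hHr : ∀ y ∈ H, r ≤ ‖y‖ := fun y hy => by
    refine hx.trans ?_
    have h1 : ‖x‖ * ‖x‖ ≤ ‖x‖ * ‖y‖ := by
      rw [← real_inner_self_eq_norm_mul_norm]
      exact le_trans hy (real_inner_le_norm x y)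
    by_cases hx0 : ‖x‖ = 0
    · rw [hx0]; positivity
    · exact le_of_mul_le_mul_left h1 (lt_of_le_of_ne (norm_nonneg _) (Ne.symm hx0))
  have hw1 : ContDiff ℝ 1 (fderiv ℝ w) := hw.fderiv_right le_rfl
  have hD : ∀ y ∈ H, ‖fderiv ℝ w y - fderiv ℝ w x‖ ≤ M₂ * ‖y - x‖ := fun y hy =>
    hHc.norm_image_sub_le_of_norm_fderiv_le (fun z _ => hw1.differentiable (by simp) z)
      (fun z hz => h2 z (hHr z hz)) hxH hy
  have hseg : ∀ e : E n, ‖e‖ = 1 → 0 ≤ inner ℝ x e →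
      h * ‖fderiv ℝ w x e‖ ≤ 2 * M₀ + h * M₂ * h := by
    intro e he hxe
    have hy : x + h • e ∈ H := by
      simp only [hH, Set.mem_ofPred_eq, inner_add_right, inner_smul_right]
      nlinarith
    have hn : ‖x + h • e - x‖ = h := by simp [norm_smul, he, abs_of_pos hh]
    have := (hHc.inter (convex_closedBall x h)).norm_image_sub_le_of_norm_fderiv_le'
      (f := w) (φ := fderiv ℝ w x) (C := h * M₂) (fun z _ => hw.differentiable (by simp) z)
      (fun z hz => (hD z hz.1).trans ?_) ⟨hxH, by simp [hh.le]⟩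
        ⟨hy, by simp [norm_smul, he, abs_of_pos hh]⟩
    · rw [hn] at this
      have e1 : h * ‖fderiv ℝ w x e‖ = ‖fderiv ℝ w x (x + h • e - x)‖ := by
        simp [norm_smul, abs_of_pos hh]
      rw [e1]
      have t1 := norm_sub_norm_le (fderiv ℝ w x (x + h • e - x)) (w (x + h • e) - w x)
      rw [norm_sub_rev (fderiv ℝ w x (x + h • e - x)) (w (x + h • e) - w x)] at t1
      have t2 := norm_sub_le (w (x + h • e)) (w x)
      linarith [h0 x hx, h0 _ (hHr _ hy)]
    · have : ‖z - x‖ ≤ h := by simpa [dist_eq_norm] using hz.2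
      nlinarith
  have hunit : ∀ e : E n, ‖e‖ = 1 → h * ‖fderiv ℝ w x e‖ ≤ 2 * M₀ + h * M₂ * h := by
    intro e he
    rcases le_total 0 (inner ℝ x e) with h' | h'
    · exact hseg e he h'
    · simpa using hseg (-e) (by simpa using he) (by simpa using h')
  refine ContinuousLinearMap.opNorm_le_of_unit_norm (by positivity) fun e he => ?_
  have := hunit e he
  rw [show 2 * M₀ / h + h * M₂ = (2 * M₀ + h * M₂ * h) / h by field_simp, le_div_iff₀ hh]
  linarith

/-- If every upper bound `B` of `φ` on `s` can be improved to `c + B / 2`, then `φ ≤ 2 c`. -/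
theorem le_of_forall_bound_improve {α : Type*} {s : Set α} {φ : α → ℝ} {c : ℝ}
    (hb : ∃ B, ∀ x ∈ s, φ x ≤ B) (h : ∀ B, (∀ x ∈ s, φ x ≤ B) → ∀ x ∈ s, φ x ≤ c + B / 2) :
    ∀ x ∈ s, φ x ≤ 2 * c := by
  intro x hx
  obtain ⟨B, hB⟩ := hb
  have hbdd : BddAbove (φ '' s) := ⟨B, by rintro _ ⟨y, hy, rfl⟩; exact hB y hy⟩
  have h1 : ∀ y ∈ s, φ y ≤ sSup (φ '' s) := fun y hy => le_csSup hbdd ⟨y, hy, rfl⟩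
  have h2 : sSup (φ '' s) ≤ c + sSup (φ '' s) / 2 :=
    csSup_le ⟨_, x, hx, rfl⟩ (by rintro _ ⟨y, hy, rfl⟩; exact h _ h1 y hy)
  linarith [h1 x hx]

/-- Interpolation of the first derivative between orders `0` and `m + 1` outside a ball. -/
theorem norm_fderiv_interpolation (m : ℕ) : ∃ A : ℝ, 0 < A ∧
    ∀ (F : Type) [NormedAddCommGroup F] [NormedSpace ℝ F] (w : E n → F) (_ : ContDiff ℝ ∞ w)
      (r h M₀ M : ℝ) (_ : 0 < h)
      (_ : ∀ j, ∃ B, ∀ x, r ≤ ‖x‖ → ‖iteratedFDeriv ℝ j w x‖ ≤ B)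
      (_ : ∀ x, r ≤ ‖x‖ → ‖w x‖ ≤ M₀)
      (_ : ∀ x, r ≤ ‖x‖ → ‖iteratedFDeriv ℝ (m + 1) w x‖ ≤ M),
      ∀ x, r ≤ ‖x‖ → ‖fderiv ℝ w x‖ ≤ A * (M₀ / h + h ^ m * M) := by
  induction m with
  | zero =>
    refine ⟨1, one_pos, fun F _ _ w _ r h M₀ M hh _ h0 h1 x hx => ?_⟩
    have hM0 : 0 ≤ M₀ := (norm_nonneg _).trans (h0 x hx)
    have := h1 x hx
    rw [zero_add, norm_iteratedFDeriv_one] at this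
    have : 0 ≤ M₀ / h := by positivity
    simp
    linarith
  | succ m ih =>
    obtain ⟨A, hA, ih⟩ := ih
    refine ⟨4 + (2 * A) ^ (m + 1), by positivity, fun F _ _ w hw r h M₀ M hh hb h0 h1 x hx => ?_⟩
    have hM0 : 0 ≤ M₀ := (norm_nonneg _).trans (h0 x hx)
    have hM : 0 ≤ M := (norm_nonneg _).trans (h1 x hx)
    have hw' : ContDiff ℝ ∞ (fderiv ℝ w) := hw.fderiv_right (by simp)
    have key := le_of_forall_bound_improve (s := {y : E n | r ≤ ‖y‖}) (φ := fun y => ‖fderiv ℝ w y‖)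
      (c := 2 * M₀ / h + h * (A * ((2 * A * h) ^ m * M))) ?_ ?_ x hx
    · refine key.trans ?_
      have : 0 ≤ h ^ (m + 1) * M := by positivity
      have h' : 0 ≤ (2 * A) ^ (m + 1) * (M₀ / h) := by positivity
      calc _ = 4 * (M₀ / h) + (2 * A) ^ (m + 1) * (h ^ (m + 1) * M) := by
            rw [mul_pow]; ring
        _ ≤ _ := by linarith
    · obtain ⟨B, hB⟩ := hb 1
      exact ⟨B, fun y hy => by simpa [norm_iteratedFDeriv_one] using hB y hy⟩
    · intro B hB y hy
      have h2 := ih (E n →L[ℝ] F) (fderiv ℝ w) hw' r (2 * A * h) B M (by positivity)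
        (fun j => by simpa only [norm_iteratedFDeriv_fderiv] using hb (j + 1)) hB
        (fun z hz => by simpa only [norm_iteratedFDeriv_fderiv] using h1 z hz)
      refine (norm_fderiv_le_of_exterior (contDiff_infty.1 hw 2) hh h0 h2 hy).trans
        (le_of_eq ?_)
      field_simp
      ring

/-- A pointwise decay estimate improves the decay of the first derivative. -/
theorem fderiv_decay {F : Type} [NormedAddCommGroup F] [NormedSpace ℝ F] {w : E n → F}
    (hw : ContDiff ℝ ∞ w) {ρ b q σ : ℝ} (hρ : 1 ≤ ρ) (hb : 0 ≤ b) (hq : 0 ≤ q) (hσ : 0 < σ)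
    (hder : ∀ j : ℕ, ∃ C, ∀ x, ρ ≤ ‖x‖ → ‖iteratedFDeriv ℝ j w x‖ ≤ C * ‖x‖ ^ (-(b + j)))
    (h0 : ∃ C, ∀ x, ρ ≤ ‖x‖ → ‖w x‖ ≤ C * ‖x‖ ^ (-q)) :
    ∃ C, ∀ x, ρ ≤ ‖x‖ → ‖fderiv ℝ w x‖ ≤ C * ‖x‖ ^ (-(q + 1 - σ)) := by
  obtain ⟨m, hm⟩ := exists_nat_gt ((q - b) / σ)
  obtain ⟨A, hA, hint⟩ := norm_fderiv_interpolation (n := n) m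
  obtain ⟨C₀, hC₀⟩ := h0
  choose C hC using hder
  refine ⟨A * (|C₀| + |C (m + 1)|), fun x hx => ?_⟩
  have hxp : 0 < ‖x‖ := by linarith
  have hx1 : 1 ≤ ‖x‖ := hρ.trans hx
  have bd : ∀ {c s t : ℝ} {y : E n}, 0 ≤ s → ‖x‖ ≤ ‖y‖ → t ≤ c * ‖y‖ ^ (-s) →
      t ≤ |c| * ‖x‖ ^ (-s) := by
    intro c s t y hs hy ht
    refine ht.trans ((mul_le_mul_of_nonneg_right (le_abs_self c) (by positivity)).trans ?_)
    exact mul_le_mul_of_nonneg_left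
      (Real.rpow_le_rpow_of_nonpos (by linarith) hy (by linarith)) (abs_nonneg c)
  have := hint F w hw ‖x‖ (‖x‖ ^ (1 - σ)) (|C₀| * ‖x‖ ^ (-q))
    (|C (m + 1)| * ‖x‖ ^ (-(b + (m + 1 : ℕ)))) (by positivity)
    (fun j => ⟨_, fun y hy => bd (by positivity) hy (hC j y (hx.trans hy))⟩)
    (fun y hy => bd hq hy (hC₀ y (hx.trans hy)))
    (fun y hy => bd (by positivity) hy (hC _ y (hx.trans hy))) x le_rfl
  refine this.trans ?_
  rw [mul_assoc]
  refine mul_le_mul_of_nonneg_left ?_ hA.le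
  rw [add_mul]
  refine add_le_add (le_of_eq ?_) ?_
  · rw [mul_div_assoc, ← Real.rpow_sub hxp]
    ring_nf
  · rw [← Real.rpow_mul_natCast hxp.le, mul_left_comm, ← Real.rpow_add hxp]
    refine mul_le_mul_of_nonneg_left (Real.rpow_le_rpow_of_exponent_le hx1 ?_) (abs_nonneg _)
    rw [div_lt_iff₀ hσ] at hm
    push_cast
    nlinarith

/-- A pointwise decay estimate improves the decay of all derivatives. -/
theorem iteratedFDeriv_decay_aux (j : ℕ) {σ : ℝ} (hσ : 0 < σ) (hσ1 : σ ≤ 1) {ρ : ℝ} (hρ : 1 ≤ ρ) :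
    ∀ {F : Type} [NormedAddCommGroup F] [NormedSpace ℝ F] {w : E n → F} (_ : ContDiff ℝ ∞ w)
      {b q : ℝ} (_ : 0 ≤ b) (_ : 0 ≤ q)
      (_ : ∀ j : ℕ, ∃ C, ∀ x, ρ ≤ ‖x‖ → ‖iteratedFDeriv ℝ j w x‖ ≤ C * ‖x‖ ^ (-(b + j)))
      (_ : ∃ C, ∀ x, ρ ≤ ‖x‖ → ‖w x‖ ≤ C * ‖x‖ ^ (-q)),
      ∃ C, ∀ x, ρ ≤ ‖x‖ → ‖iteratedFDeriv ℝ j w x‖ ≤ C * ‖x‖ ^ (-(q + j * (1 - σ))) := by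
  induction j with
  | zero =>
    intro F _ _ w hw b q hb hq hder h0
    simpa using h0
  | succ j ih =>
    intro F _ _ w hw b q hb hq hder h0
    obtain ⟨C, hC⟩ := ih (w := fderiv ℝ w) (hw.fderiv_right (by simp)) (b := b + 1) (q := q + 1 - σ)
      (by linarith) (by linarith)
      (fun i => by
        obtain ⟨C, hC⟩ := hder (i + 1)
        refine ⟨C, fun x hx => ?_⟩
        rw [norm_iteratedFDeriv_fderiv]
        refine (hC x hx).trans (le_of_eq ?_)
        push_cast
        ring_nf)
      (fderiv_decay hw hρ hb hq hσ hder h0)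
    refine ⟨C, fun x hx => ?_⟩
    rw [← norm_iteratedFDeriv_fderiv]
    refine (hC x hx).trans (le_of_eq ?_)
    push_cast
    ring_nf

theorem iteratedFDeriv_decay {F : Type} [NormedAddCommGroup F] [NormedSpace ℝ F] {w : E n → F}
    (hw : ContDiff ℝ ∞ w) {ρ b q δ : ℝ} (hρ : 1 ≤ ρ) (hb : 0 ≤ b) (hq : 0 ≤ q) (hδ : 0 < δ)
    (hder : ∀ j : ℕ, ∃ C, ∀ x, ρ ≤ ‖x‖ → ‖iteratedFDeriv ℝ j w x‖ ≤ C * ‖x‖ ^ (-(b + j)))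
    (h0 : ∃ C, ∀ x, ρ ≤ ‖x‖ → ‖w x‖ ≤ C * ‖x‖ ^ (-q)) (j : ℕ) :
    ∃ C, ∀ x, ρ ≤ ‖x‖ → ‖iteratedFDeriv ℝ j w x‖ ≤ C * ‖x‖ ^ (-(q - δ + j)) := by
  have hσ : 0 < min 1 (δ / (j + 1)) := lt_min one_pos (by positivity)
  obtain ⟨C, hC⟩ := iteratedFDeriv_decay_aux j hσ (min_le_left _ _) hρ hw hb hq hder h0
  refine ⟨|C|, fun x hx => (hC x hx).trans ?_⟩
  refine mul_le_mul (le_abs_self C) (Real.rpow_le_rpow_of_exponent_le (hρ.trans hx) ?_)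
    (by positivity) (abs_nonneg C)
  have h1 : min 1 (δ / (j + 1)) * (j + 1) ≤ δ := by
    rw [← le_div_iff₀ (by positivity)]; exact min_le_right _ _
  nlinarith

end Interpolation

section Homogeneous

open scoped ContDiff

variable {n : ℕ}

/-- Derivatives of a function homogeneous of degree `a` decay like `‖x‖ ^ (a - j)`. -/
theorem iteratedFDeriv_le_of_homogeneous (j : ℕ) :
    ∀ {F : Type} [NormedAddCommGroup F] [NormedSpace ℝ F] {w : E n → F} {a : ℝ}
      (_ : ContDiffOn ℝ ∞ w {0}ᶜ) (_ : ∀ c : ℝ, 0 < c → ∀ x, x ≠ 0 → w (c • x) = c ^ a • w x),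
      ∃ C, ∀ x, x ≠ 0 → ‖iteratedFDeriv ℝ j w x‖ ≤ C * ‖x‖ ^ (a - j) := by
  have hopen : IsOpen ({0}ᶜ : Set (E n)) := isOpen_compl_singleton
  induction j with
  | zero =>
    intro F _ _ w a hw hhom
    obtain ⟨C, hC⟩ := (isCompact_sphere (0 : E n) 1).exists_bound_of_continuousOn
      (hw.continuousOn.mono fun x hx => by
        rw [Set.mem_compl_singleton_iff]; rintro rfl; simp at hx)
    refine ⟨C, fun x hx => ?_⟩
    have hxp : 0 < ‖x‖ := norm_pos_iff.2 hx
    have h1 := hhom ‖x‖ hxp (‖x‖⁻¹ • x) (smul_ne_zero (inv_ne_zero hxp.ne') hx)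
    rw [smul_inv_smul₀ hxp.ne'] at h1
    rw [norm_iteratedFDeriv_zero, h1, norm_smul, Real.norm_of_nonneg (by positivity), mul_comm]
    simp only [Nat.cast_zero, sub_zero]
    refine mul_le_mul_of_nonneg_right (hC _ ?_) (by positivity)
    simp [norm_smul, hxp.ne']
  | succ j ih =>
    intro F _ _ w a hw hhom
    obtain ⟨C, hC⟩ := ih (w := fderiv ℝ w) (a := a - 1)
      (hw.fderiv_of_isOpen hopen (by simp)) fun c hc x hx => by
        have hd : ∀ y : E n, y ≠ 0 → DifferentiableAt ℝ w y := fun y hy =>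
          (hw.differentiableOn (by simp)).differentiableAt (hopen.mem_nhds hy)
        have h1 : HasFDerivAt (fun y => w (c • y)) (c • fderiv ℝ w (c • x)) x := by
          have := (hd (c • x) (smul_ne_zero hc.ne' hx)).hasFDerivAt.comp x
            ((hasFDerivAt_id x).const_smul c)
          refine this.congr_fderiv ?_
          ext v; simp
        have h2 : HasFDerivAt (fun y => w (c • y)) (c ^ a • fderiv ℝ w x) x := by
          refine ((hd x hx).hasFDerivAt.const_smul (c ^ a)).congr_of_eventuallyEq ?_
          filter_upwards [hopen.mem_nhds hx] with y hy
          exact hhom c hc y hy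
        have h3 := h1.unique h2
        rw [Real.rpow_sub_one hc.ne', div_eq_inv_mul, mul_smul, ← h3, inv_smul_smul₀ hc.ne']
    refine ⟨C, fun x hx => ?_⟩
    rw [← norm_iteratedFDeriv_fderiv]
    refine (hC x hx).trans (le_of_eq ?_)
    push_cast
    ring_nf

end Homogeneous

section Assembly

open Filter Topology
open scoped ContDiff

variable {n : ℕ}

theorem exists_smooth_extension {ρ : ℝ} (hρ : 0 ≤ ρ) {g : E n → ℝ}
    (hg : ∀ x, ρ ≤ ‖x‖ → ContDiffAt ℝ ∞ g x) :
    ∃ w : E n → ℝ, ContDiff ℝ ∞ w ∧ ∀ x, ρ + 1 < ‖x‖ → w =ᶠ[𝓝 x] g := by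
  have hχ : ContDiff ℝ ∞ fun x : E n => Real.smoothTransition (‖x‖ ^ 2 - ρ ^ 2) :=
    Real.smoothTransition.contDiff.comp ((contDiff_norm_sq ℝ).sub contDiff_const)
  refine ⟨fun x => Real.smoothTransition (‖x‖ ^ 2 - ρ ^ 2) * g x, ?_, fun x hx => ?_⟩
  · rw [contDiff_iff_contDiffAt]
    intro x
    rcases le_or_gt ρ ‖x‖ with h | h
    · exact hχ.contDiffAt.mul (hg x h)
    · refine contDiffAt_const (c := (0 : ℝ)).congr_of_eventuallyEq ?_
      filter_upwards [continuous_norm.continuousAt.eventually_lt_const h] with y hy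
      rw [Real.smoothTransition.zero_of_nonpos, zero_mul]
      nlinarith [norm_nonneg y]
  · filter_upwards [continuous_norm.continuousAt.eventually_const_lt hx] with y hy
    rw [Real.smoothTransition.one_of_one_le, one_mul]
    nlinarith

theorem exists_global_decay {F : Type*} [NormedAddCommGroup F] {g : E n → F} (hg : Continuous g)
    {ρ a C : ℝ} (hρ : 1 ≤ ρ) (ha : 0 ≤ a) (hC : ∀ x, ρ ≤ ‖x‖ → ‖g x‖ ≤ C * ‖x‖ ^ (-a)) :
    ∃ A, ∀ x, ‖g x‖ ≤ A * (1 + ‖x‖) ^ (-a) := by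
  obtain ⟨B, hB⟩ := (isCompact_closedBall (0 : E n) ρ).exists_bound_of_continuousOn hg.continuousOn
  refine ⟨|B| * (1 + ρ) ^ a + |C| * 2 ^ a, fun x => ?_⟩
  have h1 : (0 : ℝ) < 1 + ‖x‖ := by positivity
  rcases le_total ρ ‖x‖ with h | h
  · have hx : 0 < ‖x‖ := by linarith
    have h2 : ‖x‖ ^ (-a) ≤ 2 ^ a * (1 + ‖x‖) ^ (-a) := by
      have : ‖x‖ = 2 * ‖x‖ / 2 := by ring
      rw [Real.rpow_neg hx.le, Real.rpow_neg h1.le, ← div_eq_mul_inv, inv_eq_one_div,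
        div_le_div_iff₀ (by positivity) (by positivity), one_mul,
        ← Real.mul_rpow (by positivity) hx.le]
      exact Real.rpow_le_rpow h1.le (by linarith) ha
    have h3 : 0 ≤ |B| * (1 + ρ) ^ a * (1 + ‖x‖) ^ (-a) := by positivity
    calc ‖g x‖ ≤ C * ‖x‖ ^ (-a) := hC x h
      _ ≤ |C| * (2 ^ a * (1 + ‖x‖) ^ (-a)) := mul_le_mul (le_abs_self C) h2 (by positivity)
          (by positivity)
      _ ≤ _ := by linarith
  · have h2 : 1 ≤ (1 + ρ) ^ a * (1 + ‖x‖) ^ (-a) := by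
      rw [Real.rpow_neg h1.le, ← div_eq_mul_inv, one_le_div (by positivity)]
      exact Real.rpow_le_rpow h1.le (by linarith) ha
    have h3 : 0 ≤ |C| * 2 ^ a * (1 + ‖x‖) ^ (-a) := by positivity
    have h4 : ‖g x‖ ≤ |B| := (hB x (by simpa using h)).trans (le_abs_self B)
    nlinarith [abs_nonneg B]

theorem hasDecay_of_iteratedFDeriv {w : E n → ℝ} (hw : ContDiff ℝ ∞ w) {ρ a : ℝ} (hρ : 1 ≤ ρ)
    (ha : 0 ≤ a)
    (h : ∀ j : ℕ, ∃ C, ∀ x, ρ ≤ ‖x‖ → ‖iteratedFDeriv ℝ j w x‖ ≤ C * ‖x‖ ^ (-(a + j))) :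
    HasDecay a w := by
  have key : ∀ j : ℕ, ∃ A, ∀ x, ‖iteratedFDeriv ℝ j w x‖ ≤ A * (1 + ‖x‖) ^ (-a) := fun j => by
    obtain ⟨C, hC⟩ := h j
    refine exists_global_decay (hw.continuous_iteratedFDeriv (by exact_mod_cast le_top)) hρ ha
      (C := |C|) fun x hx => (hC x hx).trans ?_
    refine mul_le_mul (le_abs_self C) (Real.rpow_le_rpow_of_exponent_le (hρ.trans hx) ?_)
      (Real.rpow_nonneg (norm_nonneg _) _) (abs_nonneg C)
    have : (0 : ℝ) ≤ j := by positivity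
    linarith
  choose A hA using key
  refine ⟨|A 0| + |A 1| + |A 2|, fun z => ?_⟩
  have hz : 0 ≤ (1 + ‖z‖) ^ (-a) := by positivity
  have le : ∀ j t, |t| ≤ ‖iteratedFDeriv ℝ j w z‖ → |A j| ≤ |A 0| + |A 1| + |A 2| →
      |t| ≤ (|A 0| + |A 1| + |A 2|) * (1 + ‖z‖) ^ (-a) := fun j t h1 h2 =>
    h1.trans ((hA j z).trans (mul_le_mul_of_nonneg_right ((le_abs_self _).trans h2) hz))
  have h0 := abs_nonneg (A 0)
  have h1 := abs_nonneg (A 1)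
  have h2 := abs_nonneg (A 2)
  refine ⟨le 0 _ (by rw [norm_iteratedFDeriv_zero]; rfl) (by linarith), fun i =>
    ⟨le 1 _ ?_ (by linarith), le 2 _ ?_ (by linarith)⟩⟩
  · rw [norm_iteratedFDeriv_one]
    simpa using (fderiv ℝ w z).le_opNorm (EuclideanSpace.single i 1)
  · have hd : DifferentiableAt ℝ (fderiv ℝ w) z :=
      ((contDiff_infty.1 hw 2).fderiv_right (m := 1) le_rfl).differentiable (by simp) z
    have e : fderiv ℝ (fun y => fderiv ℝ w y (EuclideanSpace.single i 1)) z
        = (fderiv ℝ (fderiv ℝ w) z).flip (EuclideanSpace.single i 1) := by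
      rw [fderiv_clm_apply hd (differentiableAt_const _)]
      simp
    rw [e, ← norm_iteratedFDeriv_fderiv, norm_iteratedFDeriv_one]
    simpa using (fderiv ℝ (fderiv ℝ w) z).le_opNorm₂ (EuclideanSpace.single i 1)
      (EuclideanSpace.single i 1)

theorem IsPolyFun.contDiff {p : E n → ℝ} (hp : IsPolyFun n p) : ContDiff ℝ ∞ p := by
  obtain ⟨P, hP⟩ := hp
  have : p = fun x => ∑ d ∈ P.support, P.coeff d * ∏ i, x i ^ d i := by
    ext x; rw [hP, MvPolynomial.eval_eq']
  rw [this]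
  fun_prop

/-- The Kelvin transform of a harmonic homogeneous polynomial. -/
def kelvin (n k : ℕ) (p : E n → ℝ) (x : E n) : ℝ := ‖x‖ ^ ((2 : ℝ) - n - 2 * k) * p x

theorem contDiffAt_kelvin {k : ℕ} {p : E n → ℝ} (hp : IsHHP n k p) {x : E n} (hx : x ≠ 0) :
    ContDiffAt ℝ ∞ (kelvin n k p) x :=
  ((contDiffAt_norm ℝ hx).rpow_const_of_ne (norm_ne_zero_iff.2 hx)).mul hp.1.contDiff.contDiffAt

theorem iteratedFDeriv_kelvin_le {k : ℕ} {p : E n → ℝ} (hp : IsHHP n k p) (j : ℕ) :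
    ∃ C, ∀ x, x ≠ 0 → ‖iteratedFDeriv ℝ j (kelvin n k p) x‖ ≤ C * ‖x‖ ^ ((2 : ℝ) - n - k - j) := by
  refine iteratedFDeriv_le_of_homogeneous j
    (fun x hx => (contDiffAt_kelvin hp hx).contDiffWithinAt) fun c hc x hx => ?_
  rw [kelvin, kelvin, norm_smul, Real.norm_of_nonneg hc.le, hp.2.1,
    Real.mul_rpow hc.le (norm_nonneg _), smul_eq_mul]
  have : c ^ ((2 : ℝ) - n - 2 * k) * c ^ k = c ^ ((2 : ℝ) - n - k) := by
    rw [← Real.rpow_natCast c k, ← Real.rpow_add hc]; ring_nf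
  rw [← this]; ring

theorem uniqueDiffOn_exterior {R : ℝ} (hR : 0 < R) : UniqueDiffOn ℝ (Sset n R) := by
  intro x hx
  have hx : R ≤ ‖x‖ := hx
  have hxp : 0 < ‖x‖ := hR.trans_le hx
  set H : Set (E n) := {y | inner ℝ x x ≤ inner ℝ x y} with hH
  have hHS : H ⊆ Sset n R := fun y hy => by
    have h1 : ‖x‖ * ‖x‖ ≤ ‖x‖ * ‖y‖ := by
      rw [← real_inner_self_eq_norm_mul_norm]
      exact le_trans hy (real_inner_le_norm x y)
    exact hx.trans (le_of_mul_le_mul_left h1 hxp)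
  refine UniqueDiffWithinAt.mono ?_ hHS
  have hHc : Convex ℝ H := convex_halfSpace_ge (innerSL ℝ x).toLinearMap.isLinear _
  have hopen : IsOpen {y : E n | inner ℝ x x < inner ℝ x y} :=
    isOpen_lt continuous_const (by fun_prop)
  have h2 : (2 : ℝ) • x ∈ interior H := by
    refine interior_mono (s := {y : E n | inner ℝ x x < inner ℝ x y}) (fun y hy =>
        le_of_lt (show inner ℝ x x < inner ℝ x y from hy)) ?_
    rw [hopen.interior_eq]
    change inner ℝ x x < inner ℝ x ((2 : ℝ) • x)
    rw [inner_smul_right, real_inner_self_eq_norm_mul_norm]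
    nlinarith
  exact uniqueDiffWithinAt_convex hHc ⟨_, h2⟩ (subset_closure (le_refl (inner ℝ x x)))

theorem exterior_mem_nhds {R : ℝ} {x : E n} (hx : R < ‖x‖) : Sset n R ∈ 𝓝 x := by
  filter_upwards [continuous_norm.continuousAt.eventually_const_lt hx] with y hy
  exact le_of_lt hy

theorem lapW_eq_lap {R : ℝ} {u w : E n → ℝ} {x : E n} (hx : R < ‖x‖) (h : w =ᶠ[𝓝 x] u) :
    lapW n R u x = lap n w x := by
  simp only [lapW, lap]
  refine Finset.sum_congr rfl fun i _ => ?_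
  rw [fderivWithin_of_mem_nhds (exterior_mem_nhds hx)]
  congr 1
  refine Filter.EventuallyEq.fderiv_eq ?_
  filter_upwards [continuous_norm.continuousAt.eventually_const_lt hx,
    h.fderiv (𝕜 := ℝ)] with y hy hy'
  rw [fderivWithin_of_mem_nhds (exterior_mem_nhds hy), hy']

end Assembly

section Multipole

open MeasureTheory
open scoped ContDiff

variable {n : ℕ}

/-- A decaying function of `r` bounded by `r⁻¹` relative to `r ^ (2 - n)` has no monopole term. -/
theorem eq_zero_of_kelvin_zero_decay (hn : 1 ≤ n) {p : E n → ℝ} (hp : IsHHP n 0 p) {ρ C : ℝ}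
    (h : ∀ x, ρ ≤ ‖x‖ → |kelvin n 0 p x| ≤ C * ‖x‖ ^ (-((n : ℝ) - 1))) (x : E n) : p x = 0 := by
  have hc : ∀ y, p y = p 0 := fun y => by simpa using (hp.2.1 0 y).symm
  rw [hc x]
  by_contra hne
  have hpos : 0 < |p 0| := abs_pos.2 hne
  set t := max (max ρ 1) ((|C| + 1) / |p 0|) with ht
  have ht1 : 1 ≤ t := (le_max_right ρ 1).trans (le_max_left _ _)
  have htp : 0 < t := by linarith
  have htn : ‖(EuclideanSpace.single ⟨0, hn⟩ t : E n)‖ = t := by simp [abs_of_pos htp]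
  have h1 := h (EuclideanSpace.single ⟨0, hn⟩ t) (by
    rw [htn]; exact (le_max_left ρ 1).trans (le_max_left _ _))
  rw [kelvin, hc, htn, abs_mul, abs_of_pos (by positivity)] at h1
  have e : t ^ ((2 : ℝ) - n - 2 * (0 : ℕ)) = t * t ^ (-((n : ℝ) - 1)) := by
    nth_rewrite 2 [← Real.rpow_one t]
    rw [← Real.rpow_add htp]
    congr 1
    push_cast
    ring
  rw [e] at h1
  have h2 : t * |p 0| ≤ C := by
    have : 0 < t ^ (-((n : ℝ) - 1)) := by positivity
    nlinarith
  have h3 : |C| + 1 ≤ t * |p 0| := by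
    rw [← div_le_iff₀ hpos]; exact le_max_right _ _
  linarith [le_abs_self C]

theorem exists_multipole_expansion (hn : 4 ≤ n) {w : E n → ℝ} (hw : ContDiff ℝ ∞ w) {ρ : ℝ}
    (hρ : 1 ≤ ρ)
    (hder : ∀ j : ℕ, ∃ C, ∀ x, ρ ≤ ‖x‖ → ‖iteratedFDeriv ℝ j w x‖ ≤ C * ‖x‖ ^ (-((n : ℝ) - 1 + j)))
    (hlap : ∃ C, ∀ x, ρ ≤ ‖x‖ → |lap n w x| ≤ C * ‖x‖ ^ (-(2 * (n : ℝ)))) :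
    ∃ p : ℕ → E n → ℝ, (∀ k ∈ Finset.Icc 1 (n - 1), IsHHP n k (p k)) ∧
      ∃ C, ∀ x, ρ ≤ ‖x‖ → |w x - ∑ k ∈ Finset.Icc 1 (n - 1), kelvin n k (p k) x|
        ≤ C * ‖x‖ ^ (-(2 * (n : ℝ) - 3 + 3 / 4)) := by
  have hn' : (4 : ℝ) ≤ n := by exact_mod_cast hn
  obtain ⟨l, hl⟩ : ∃ l : ℝ, 2 * l + 2 = n := ⟨(n - 2) / 2, by ring⟩
  have hl1 : 1 ≤ l := by linarith
  have hw2 : ContDiff ℝ 2 w := contDiff_infty.1 hw 2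
  set f := lap n w with hf_def
  have hf : Continuous f := continuous_lap hw2
  obtain ⟨C₁, hC₁⟩ := hlap
  obtain ⟨A, hA⟩ := exists_global_decay hf hρ (a := 2 * (n : ℝ)) (by linarith) hC₁
  have hA' : ∀ y, |f y| ≤ A * (1 + ‖y‖) ^ (-(2 * (n : ℝ))) := hA
  have hA0 : 0 ≤ A := by simpa using (abs_nonneg _).trans (hA' 0)
  have hAb : ∀ y, |f y| ≤ A := fun y => (hA' y).trans (mul_le_of_le_one_right hA0
    (Real.rpow_le_one_of_one_le_of_nonpos (by linarith [norm_nonneg y]) (by linarith)))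
  have hmom : ∀ k < n, Integrable (fun y => ‖y‖ ^ k * f y) := fun k hk => by
    have hk : (k : ℝ) < n := by exact_mod_cast hk
    have := integrable_rpow_mul_of_decay hf hA' (b := k) (by positivity) (by linarith)
    simpa using this
  have hfi : Integrable f := by simpa using hmom 0 (by omega)
  have hrep : ∀ x, ∫ y, ‖x - y‖ ^ (-(2 * l)) * f y = -newtonConst n l * w x := fun x =>
    representation hl hl1 hw2 (a := (n : ℝ) - 1) (by linarith)
      (hasDecay_of_iteratedFDeriv hw hρ (by linarith) hder) x
      (integrable_kernel_mul hl (by linarith) hf hfi hAb x)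
  have hK : 0 < newtonConst n l := newtonConst_pos hl (by linarith)
  set K := newtonConst n l
  obtain ⟨C, hC⟩ := potential_expansion hl hl1 hf hA' (n - 1) (β := (n : ℝ) - 1 + 3 / 4)
    (by push_cast [Nat.cast_sub (by omega : 1 ≤ n)]; linarith)
    (by push_cast [Nat.cast_sub (by omega : 1 ≤ n)]; linarith) (by linarith)
  set p : ℕ → E n → ℝ := fun k x =>
    -K⁻¹ * MvPolynomial.eval (fun i => x i) (zonalMoment l f k) with hp_def
  have hp : ∀ k < n, IsHHP n k (p k) := fun k hk => isHHP_zonalMoment hl hf (hmom k hk) _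
  have hexp : ∀ x, ρ ≤ ‖x‖ → |w x - ∑ k ∈ Finset.range n, kelvin n k (p k) x|
      ≤ K⁻¹ * C * ‖x‖ ^ (-(2 * (n : ℝ) - 3 + 3 / 4)) := fun x hx => by
    have h1 := hC x (hρ.trans hx)
    rw [hrep, Nat.sub_add_cancel (by omega : 1 ≤ n)] at h1
    have e1 : w x - ∑ k ∈ Finset.range n, kelvin n k (p k) x = -K⁻¹ * (-K * w x -
        ∑ k ∈ Finset.range n, ‖x‖ ^ (-(2 * l) - 2 * k) *
          MvPolynomial.eval (fun i => x i) (zonalMoment l f k)) := by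
      rw [mul_sub, Finset.mul_sum, ← mul_assoc, neg_mul_neg, inv_mul_cancel₀ hK.ne', one_mul]
      congr 1
      refine Finset.sum_congr rfl fun k _ => ?_
      rw [kelvin, ← hl, hp_def]
      ring_nf
    rw [e1, abs_mul, abs_neg, abs_of_pos (inv_pos.2 hK), mul_assoc]
    refine mul_le_mul_of_nonneg_left (h1.trans (le_of_eq ?_)) (by positivity)
    rw [← hl]
    ring_nf
  have hsplit : ∀ x, ∑ k ∈ Finset.range n, kelvin n k (p k) x
      = kelvin n 0 (p 0) x + ∑ k ∈ Finset.Icc 1 (n - 1), kelvin n k (p k) x := fun x => by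
    have : Finset.range n = insert 0 (Finset.Icc 1 (n - 1)) := by
      ext k; simp only [Finset.mem_range, Finset.mem_insert, Finset.mem_Icc]; omega
    rw [this, Finset.sum_insert (by simp)]
  have hterm : ∀ k, ∃ B, 0 ≤ B ∧ ∀ x, ρ ≤ ‖x‖ → k ∈ Finset.Icc 1 (n - 1) →
      |kelvin n k (p k) x| ≤ B * ‖x‖ ^ (-((n : ℝ) - 1)) := fun k => by
    by_cases hk : k ∈ Finset.Icc 1 (n - 1)
    · have hk' := Finset.mem_Icc.1 hk
      have hk1 : (1 : ℝ) ≤ k := by exact_mod_cast hk'.1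
      obtain ⟨B, hB⟩ := iteratedFDeriv_kelvin_le (hp k (by omega)) 0
      refine ⟨|B|, abs_nonneg _, fun x hx _ => ?_⟩
      have hx0 : x ≠ 0 := norm_pos_iff.1 (by linarith)
      have := hB x hx0
      rw [norm_iteratedFDeriv_zero, Real.norm_eq_abs] at this
      refine this.trans (mul_le_mul (le_abs_self B)
        (Real.rpow_le_rpow_of_exponent_le (hρ.trans hx) ?_) (by positivity) (abs_nonneg _))
      push_cast
      linarith
    · exact ⟨0, le_rfl, fun x _ h => absurd h hk⟩
  choose B hB0 hB using hterm
  obtain ⟨C₀, hC₀⟩ := hder 0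
  have hzero : ∀ x, p 0 x = 0 := by
    refine eq_zero_of_kelvin_zero_decay (by omega) (hp 0 (by omega)) (ρ := ρ)
      (C := |C₀| + K⁻¹ * |C| + ∑ k ∈ Finset.Icc 1 (n - 1), B k) fun x hx => ?_
    have hx1 := hρ.trans hx
    have b1 : |w x| ≤ |C₀| * ‖x‖ ^ (-((n : ℝ) - 1)) := by
      have := hC₀ x hx
      rw [norm_iteratedFDeriv_zero, Real.norm_eq_abs, Nat.cast_zero, add_zero] at this
      exact this.trans (mul_le_mul_of_nonneg_right (le_abs_self _) (by positivity))
    have b2 : |w x - ∑ k ∈ Finset.range n, kelvin n k (p k) x|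
        ≤ K⁻¹ * |C| * ‖x‖ ^ (-((n : ℝ) - 1)) := by
      refine (hexp x hx).trans (mul_le_mul
        (mul_le_mul_of_nonneg_left (le_abs_self C) (by positivity))
        (Real.rpow_le_rpow_of_exponent_le hx1 (by linarith)) (by positivity) (by positivity))
    have b3 : |∑ k ∈ Finset.Icc 1 (n - 1), kelvin n k (p k) x|
        ≤ (∑ k ∈ Finset.Icc 1 (n - 1), B k) * ‖x‖ ^ (-((n : ℝ) - 1)) := by
      rw [Finset.sum_mul]
      exact (Finset.abs_sum_le_sum_abs _ _).trans (Finset.sum_le_sum fun k hk => hB k x hx hk)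
    have e : kelvin n 0 (p 0) x = w x - (w x - ∑ k ∈ Finset.range n, kelvin n k (p k) x)
        - ∑ k ∈ Finset.Icc 1 (n - 1), kelvin n k (p k) x := by rw [hsplit]; ring
    rw [e]
    refine (abs_sub _ _).trans ((add_le_add ((abs_sub _ _).trans (add_le_add b1 b2)) b3).trans ?_)
    rw [← add_mul, ← add_mul]
  refine ⟨p, fun k hk => hp k (by have := Finset.mem_Icc.1 hk; omega), K⁻¹ * C, fun x hx => ?_⟩
  have := hexp x hx
  rwa [hsplit, kelvin, hzero, mul_zero, zero_add] at this

end Multipole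

section Exterior

open Filter Topology
open scoped ContDiff

variable {n : ℕ}

theorem bigOh_iff {R q : ℝ} (hR : 0 < R) {u : E n → ℝ} : BigOh n R q u ↔ ∀ j : ℕ, ∃ C : ℝ,
    ∀ x ∈ Sset n R, ‖iteratedFDerivWithin ℝ j u (Sset n R) x‖ ≤ C * ‖x‖ ^ (-(q + j)) := by
  refine forall_congr' fun j => exists_congr fun C => forall₂_congr fun x hx => ?_
  have hx : 0 < ‖x‖ := hR.trans_le hx
  rw [neg_add, Real.rpow_add hx, Real.rpow_neg hx.le (j : ℝ), Real.rpow_natCast, ← mul_assoc,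
    ← div_eq_mul_inv, le_div_iff₀ (by positivity), mul_comm]

theorem bigOh_of_eventually {R ρ q : ℝ} (hR : 0 < R) {u : E n → ℝ}
    (hu : ContDiffOn ℝ ∞ u (Sset n R)) (hq : 0 ≤ q)
    (h : ∀ j : ℕ, ∃ C : ℝ, ∀ x, R < ‖x‖ → ρ ≤ ‖x‖ →
        ‖iteratedFDeriv ℝ j u x‖ ≤ C * ‖x‖ ^ (-(q + j))) :
    BigOh n R q u := by
  rw [bigOh_iff hR]
  intro j
  obtain ⟨C, hC⟩ := h j
  set r := max ρ (R + 1) with hr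
  have hrR : R + 1 ≤ r := le_max_right _ _
  have hclosed : IsClosed (Sset n R) := isClosed_le continuous_const continuous_norm
  obtain ⟨B, hB⟩ :=
    ((isCompact_closedBall (0 : E n) r).inter_left hclosed).exists_bound_of_continuousOn
    ((hu.continuousOn_iteratedFDerivWithin (m := j) (by exact_mod_cast le_top)
      (uniqueDiffOn_exterior hR)).mono Set.inter_subset_left)
  refine ⟨|B| * r ^ (q + j) + |C|, fun x hx => ?_⟩
  have hxp : 0 < ‖x‖ := hR.trans_le hx
  have hpow : 0 ≤ ‖x‖ ^ (-(q + j)) := by positivity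
  rw [add_mul]
  rcases le_total ‖x‖ r with hxr | hxr
  · have h1 : 1 ≤ r ^ (q + j) * ‖x‖ ^ (-(q + j)) := by
      rw [Real.rpow_neg hxp.le, ← div_eq_mul_inv, one_le_div (by positivity)]
      exact Real.rpow_le_rpow hxp.le hxr (by positivity)
    have h2 := (hB x ⟨hx, by simpa using hxr⟩).trans (le_abs_self B)
    have h3 : 0 ≤ |C| * ‖x‖ ^ (-(q + j)) := by positivity
    nlinarith [abs_nonneg B]
  · have hxR : R < ‖x‖ := by linarith
    rw [iteratedFDerivWithin_eq_iteratedFDeriv (uniqueDiffOn_exterior hR)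
      ((hu.contDiffAt (exterior_mem_nhds hxR)).of_le (by exact_mod_cast le_top)) hx]
    have h2 := hC x hxR ((le_max_left _ _).trans hxr)
    have h3 : 0 ≤ |B| * r ^ (q + j) * ‖x‖ ^ (-(q + j)) := by positivity
    have h4 := mul_le_mul_of_nonneg_right (le_abs_self C) hpow
    linarith

theorem contDiffAt_sum_kelvin {s : Finset ℕ} {p : ℕ → E n → ℝ} (hp : ∀ k ∈ s, IsHHP n k (p k))
    {x : E n} (hx : x ≠ 0) : ContDiffAt ℝ ∞ (fun y => ∑ k ∈ s, kelvin n k (p k) y) x :=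
  ContDiffAt.sum fun k hk => contDiffAt_kelvin (hp k hk) hx

theorem iteratedFDeriv_sum_kelvin_le {s : Finset ℕ} {p : ℕ → E n → ℝ}
    (hp : ∀ k ∈ s, IsHHP n k (p k)) (hs : ∀ k ∈ s, 1 ≤ k) (j : ℕ) :
    ∃ C, ∀ x, 1 ≤ ‖x‖ → ‖iteratedFDeriv ℝ j (fun y => ∑ k ∈ s, kelvin n k (p k) y) x‖
      ≤ C * ‖x‖ ^ (-((n : ℝ) - 1 + j)) := by
  have h : ∀ k, ∃ C, k ∈ s → ∀ x, 1 ≤ ‖x‖ → ‖iteratedFDeriv ℝ j (kelvin n k (p k)) x‖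
      ≤ C * ‖x‖ ^ (-((n : ℝ) - 1 + j)) := fun k => by
    by_cases hk : k ∈ s
    · obtain ⟨C, hC⟩ := iteratedFDeriv_kelvin_le (hp k hk) j
      refine ⟨|C|, fun _ x hx => (hC x (norm_pos_iff.1 (by linarith))).trans ?_⟩
      have hk1 : (1 : ℝ) ≤ k := by exact_mod_cast hs k hk
      exact mul_le_mul (le_abs_self C) (Real.rpow_le_rpow_of_exponent_le hx (by linarith))
        (by positivity) (abs_nonneg C)
    · exact ⟨0, fun h => absurd h hk⟩
  choose C hC using h
  refine ⟨∑ k ∈ s, C k, fun x hx => ?_⟩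
  have hx0 : x ≠ 0 := norm_pos_iff.1 (by linarith)
  rw [iteratedFDeriv_fun_sum_apply fun k hk =>
    (contDiffAt_kelvin (hp k hk) hx0).of_le (by exact_mod_cast le_top), Finset.sum_mul]
  exact (norm_sum_le _ _).trans (Finset.sum_le_sum fun k hk => hC k hk x hx)

end Exterior

/-- if `u = O(-(n-1))` and `Δu = O(-2n)` on `{|x| ≥ R}`, then the
terms of order `r^{1-n}` through `r^{3-2n}` in the expansion of `u` are harmonic:
`u = Σ_{k=1}^{n-1} |x|^{2-n-2k} p_k(x) + O(-(2n-3)-ε)` with `p_k` harmonic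
homogeneous of degree `k`. -/
theorem first_terms_harmonic (n : ℕ) (hn : 4 ≤ n) (R : ℝ) (hR : 1 ≤ R)
    (u : E n → ℝ) (husmooth : ContDiffOn ℝ (⊤ : ℕ∞) u (Sset n R))
    (huO : BigOh n R ((n:ℝ) - 1) u)
    (hlapO : BigOh n R (2 * n) (lapW n R u)) :
    ∃ p : ℕ → (E n → ℝ), (∀ k ∈ Finset.Icc 1 (n - 1), IsHHP n k (p k)) ∧
      ∃ ε : ℝ, ε ∈ Set.Ioo (0:ℝ) 1 ∧
        BigOh n R (2 * (n:ℝ) - 3 + ε)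
          (fun x => u x - ∑ k ∈ Finset.Icc 1 (n - 1), ‖x‖ ^ ((2:ℝ) - n - 2 * k) * p k x) := by
  have hR0 : 0 < R := by linarith
  have hn' : (4 : ℝ) ≤ n := by exact_mod_cast hn
  have hu : ∀ x, R < ‖x‖ → ContDiffAt ℝ (⊤ : ℕ∞) u x := fun x hx =>
    husmooth.contDiffAt (exterior_mem_nhds hx)
  obtain ⟨w, hw, hwu⟩ := exists_smooth_extension (ρ := R + 1) (by linarith) (g := u)
    fun x hx => hu x (by linarith)
  have hder : ∀ j : ℕ, ∃ C, ∀ x, R + 3 ≤ ‖x‖ →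
      ‖iteratedFDeriv ℝ j w x‖ ≤ C * ‖x‖ ^ (-((n : ℝ) - 1 + j)) := fun j => by
    obtain ⟨C, hC⟩ := (bigOh_iff hR0).1 huO j
    refine ⟨C, fun x hx => ?_⟩
    have hxS : x ∈ Sset n R := le_trans (by linarith) hx
    rw [((hwu x (by linarith)).iteratedFDeriv ℝ j).eq_of_nhds,
      ← iteratedFDerivWithin_eq_iteratedFDeriv (uniqueDiffOn_exterior hR0)
        ((hu x (by linarith)).of_le (by exact_mod_cast le_top)) hxS]
    exact hC x hxS
  have hlap : ∃ C, ∀ x, R + 3 ≤ ‖x‖ → |lap n w x| ≤ C * ‖x‖ ^ (-(2 * (n : ℝ))) := by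
    obtain ⟨C, hC⟩ := hlapO 0
    refine ⟨C, fun x hx => ?_⟩
    have := hC x (le_trans (by linarith) hx)
    rwa [pow_zero, one_mul, norm_iteratedFDerivWithin_zero, Real.norm_eq_abs,
      lapW_eq_lap (by linarith) (hwu x (by linarith))] at this
  obtain ⟨p, hp, C, hC⟩ := exists_multipole_expansion hn hw (by linarith) hder hlap
  have hs : ∀ k ∈ Finset.Icc 1 (n - 1), 1 ≤ k := fun k hk => (Finset.mem_Icc.1 hk).1
  set T : E n → ℝ := fun x => ∑ k ∈ Finset.Icc 1 (n - 1), kelvin n k (p k) x with hT_def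
  have hT : ∀ x, R ≤ ‖x‖ → ContDiffAt ℝ (⊤ : ℕ∞) T x := fun x hx =>
    contDiffAt_sum_kelvin hp (norm_pos_iff.1 (by linarith))
  obtain ⟨v, hv, hvu⟩ := exists_smooth_extension (ρ := R + 1) (by linarith)
    (g := fun x => u x - T x) fun x hx => (hu x (by linarith)).sub (hT x (by linarith))
  have hvw : ∀ x, R + 3 ≤ ‖x‖ → Filter.EventuallyEq (nhds x) v fun y => w y - T y := fun x hx => by
    filter_upwards [hvu x (by linarith), hwu x (by linarith)] with y h1 h2
    rw [h1, h2]
  have hvder : ∀ j : ℕ, ∃ C, ∀ x, R + 3 ≤ ‖x‖ →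
      ‖iteratedFDeriv ℝ j v x‖ ≤ C * ‖x‖ ^ (-((n : ℝ) - 1 + j)) := fun j => by
    obtain ⟨C₁, hC₁⟩ := hder j
    obtain ⟨C₂, hC₂⟩ := iteratedFDeriv_sum_kelvin_le hp hs j
    refine ⟨C₁ + C₂, fun x hx => ?_⟩
    rw [((hvw x hx).iteratedFDeriv ℝ j).eq_of_nhds, fun_iteratedFDeriv_sub_apply
      (hw.contDiffAt.of_le (by exact_mod_cast le_top))
      ((hT x (by linarith)).of_le (by exact_mod_cast le_top)), add_mul]
    exact (norm_sub_le _ _).trans (add_le_add (hC₁ x hx) (hC₂ x (by linarith)))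
  have hdecay := iteratedFDeriv_decay hv (ρ := R + 3) (b := (n : ℝ) - 1)
    (q := 2 * (n : ℝ) - 3 + 3 / 4) (δ := 1 / 4) (by linarith) (by linarith) (by linarith)
    (by norm_num) hvder ⟨C, fun x hx => by rw [(hvw x hx).eq_of_nhds]; exact hC x hx⟩
  refine ⟨p, hp, 1 / 2, ⟨by norm_num, by norm_num⟩, ?_⟩
  refine bigOh_of_eventually (ρ := R + 3) hR0
    (husmooth.sub fun x hx => (hT x hx).contDiffWithinAt) (by linarith) fun j => ?_
  obtain ⟨B, hB⟩ := hdecay j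
  refine ⟨B, fun x _ hx => ?_⟩
  have := hB x hx
  rw [((hvu x (by linarith)).iteratedFDeriv ℝ j).eq_of_nhds] at this
  refine this.trans (le_of_eq ?_)
  ring_nf
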